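/- Let H be a nearest-neighbor one-dimensional SFT presented by a finite directed graph G = (A, E) in which every vertex has at least one outgoing and one incoming edge, and suppose G does not satisfy condition D. Then for every finite alphabet B and every two-dimensional SFT Y ⊆ B^{ℤ²}, there exist a one-dimensional SFT V ⊆ A^ℤ and positive integers m, n such that the combined subshift X_{H,V} is an (m,n)-th root of Y. -/

import Mathlib

open Filter

/-- Shift on one-dimensional configurations: `(shift1 p x) k = x (k - p)`. -/
def shift1 {A : Type*} (p : ℤ) (x : ℤ → A) : ℤ → A := fun k => x (k - p)

/-- Shift on two-dimensional configurations: `(shift2 v x) k = x (k - v)`. -/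
def shift2 {A : Type*} (v : ℤ × ℤ) (x : ℤ × ℤ → A) : ℤ × ℤ → A := fun k => x (k - v)

/-- The finite word `w` occurs in the bi-infinite sequence `x`. -/
def occursIn1 {A : Type*} (w : List A) (x : ℤ → A) : Prop :=
  ∃ i : ℤ, ∀ (n : ℕ) (h : n < w.length), x (i + n) = w.get ⟨n, h⟩

/-- The one-dimensional SFT avoiding the finite set `F` of forbidden words. -/
def SFT1 {A : Type*} (F : Finset (List A)) : Set (ℤ → A) :=
  {x | ∀ w ∈ F, ¬ occursIn1 w x}

/-- `H` is a one-dimensional subshift of finite type. -/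
def IsSFT1 {A : Type*} (H : Set (ℤ → A)) : Prop :=
  ∃ F : Finset (List A), H = SFT1 F

/-- A finite two-dimensional pattern: a finite support together with values. -/
structure Pattern2 (A : Type*) where
  support : Finset (ℤ × ℤ)
  val : ℤ × ℤ → A

/-- The pattern `p` occurs in the configuration `x`. -/
def Pattern2.OccursIn {A : Type*} (p : Pattern2 A) (x : ℤ × ℤ → A) : Prop :=
  ∃ v : ℤ × ℤ, ∀ u ∈ p.support, x (u + v) = p.val u

/-- The two-dimensional SFT avoiding the finite set `F` of forbidden patterns. -/
def SFT2 {A : Type*} (F : Finset (Pattern2 A)) : Set (ℤ × ℤ → A) :=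
  {x | ∀ p ∈ F, ¬ p.OccursIn x}

/-- The SFT `X_F` with added horizontal constraints from `H`: every row lies in `H`
and no pattern of `F` occurs. -/
def XHF {A : Type*} (H : Set (ℤ → A)) (F : Finset (Pattern2 A)) : Set (ℤ × ℤ → A) :=
  {x | (∀ j : ℤ, (fun k => x (k, j)) ∈ H) ∧ ∀ p ∈ F, ¬ p.OccursIn x}

/-- The combined subshift: rows in `H`, columns in `V`. -/
def XHV {A : Type*} (H V : Set (ℤ → A)) : Set (ℤ × ℤ → A) :=
  {x | (∀ j : ℤ, (fun k => x (k, j)) ∈ H) ∧ ∀ i : ℤ, (fun l => x (i, l)) ∈ V}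

/-- Number of restrictions of elements of `X` to `[0,m) × [0,n)`. -/
noncomputable def patCount2 {A : Type*} (X : Set (ℤ × ℤ → A)) (m n : ℕ) : ℕ :=
  Set.ncard {p : Fin m → Fin n → A |
    ∃ x ∈ X, ∀ (i : Fin m) (j : Fin n), x ((i : ℤ), (j : ℤ)) = p i j}

/-- Topological entropy of a two-dimensional subshift. -/
noncomputable def entropy2 {A : Type*} (X : Set (ℤ × ℤ → A)) : ℝ :=
  ⨅ n : ℕ, Real.logb 2 (patCount2 X (n + 1) (n + 1)) / ((n : ℝ) + 1) ^ 2

/-- The word `w` belongs to the language of `H`. -/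
def wordIn {A : Type*} (H : Set (ℤ → A)) (w : List A) : Prop :=
  ∃ x ∈ H, occursIn1 w x

/-- Number of length-`n` words in the language of `H`. -/
noncomputable def wordCount {A : Type*} (H : Set (ℤ → A)) (n : ℕ) : ℕ :=
  Set.ncard {w : List A | w.length = n ∧ wordIn H w}

/-- Topological entropy of a one-dimensional subshift. -/
noncomputable def entropy1 {A : Type*} (H : Set (ℤ → A)) : ℝ :=
  ⨅ n : ℕ, Real.logb 2 (wordCount H (n + 1)) / ((n : ℝ) + 1)

/-- `X` is a two-dimensional subshift (closed and shift-invariant). -/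
def IsSubshift2 {A : Type*} [TopologicalSpace A] (X : Set (ℤ × ℤ → A)) : Prop :=
  IsClosed X ∧ ∀ (v : ℤ × ℤ) (x : ℤ × ℤ → A), x ∈ X → shift2 v x ∈ X

/-- `X` is an `(m,n)`-th root of `Y`. -/
def IsRoot {A B : Type*} [TopologicalSpace A] [TopologicalSpace B]
    (X : Set (ℤ × ℤ → A)) (Y : Set (ℤ × ℤ → B)) (m n : ℕ) : Prop :=
  ∃ Z : Set (ℤ × ℤ → A), Z ⊆ X ∧ IsClopen {x : X | (x : ℤ × ℤ → A) ∈ Z} ∧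
    shift2 ((m : ℤ), 0) '' Z = Z ∧ shift2 (0, (n : ℤ)) '' Z = Z ∧
    (∃ φ : Z ≃ₜ Y,
      ∀ (x : Z) (k₁ k₂ : ℤ)
        (hx : shift2 (k₁ * (m : ℤ), k₂ * (n : ℤ)) (x : ℤ × ℤ → A) ∈ Z),
        (φ ⟨shift2 (k₁ * (m : ℤ), k₂ * (n : ℤ)) (x : ℤ × ℤ → A), hx⟩ : ℤ × ℤ → B) =
          shift2 (k₁, k₂) (φ x : ℤ × ℤ → B)) ∧
    (∀ i j : ℕ, i < m → j < n → shift2 ((i : ℤ), (j : ℤ)) '' Z ⊆ X) ∧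
    ∀ x ∈ X, ∃! q : Fin m × Fin n, x ∈ shift2 ((q.1 : ℤ), (q.2 : ℤ)) '' Z

/-- The vertex shift (nearest-neighbor SFT) of a directed graph on `A`. -/
def vertexShift {A : Type*} (E : A → A → Prop) : Set (ℤ → A) :=
  {x | ∀ i : ℤ, E (x i) (x (i + 1))}

/-- Strongly connected component: a maximal nonempty set whose vertices are pairwise
joined by nonempty directed paths. -/
def IsSCC {A : Type*} (E : A → A → Prop) (S : Set A) : Prop :=
  S.Nonempty ∧ (∀ a ∈ S, ∀ b ∈ S, Relation.TransGen E a b) ∧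
    ∀ T : Set A, S ⊆ T → (∀ a ∈ T, ∀ b ∈ T, Relation.TransGen E a b) → T = S

def ReflexiveType {A : Type*} (E : A → A → Prop) (S : Set A) : Prop :=
  ∀ v ∈ S, E v v

def SymmetricType {A : Type*} (E : A → A → Prop) (S : Set A) : Prop :=
  ∀ v ∈ S, ∀ w ∈ S, v ≠ w → E v w → E w v

def StateSplitType {A : Type*} (E : A → A → Prop) (S : Set A) : Prop :=
  ∃ p : ℕ, 0 < p ∧ ∃ f : A → ZMod p,
    (∀ i : ZMod p, ∃ v ∈ S, f v = i) ∧
    ∀ v ∈ S, ∀ w ∈ S, (E v w ↔ f w = f v + 1)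

/-- Condition D: all SCCs share one of the three types. -/
def ConditionD {A : Type*} (E : A → A → Prop) : Prop :=
  (∀ S : Set A, IsSCC E S → ReflexiveType E S) ∨
  (∀ S : Set A, IsSCC E S → SymmetricType E S) ∨
  (∀ S : Set A, IsSCC E S → StateSplitType E S)

/-- A real is Π₁-computable (right-recursively enumerable). -/
def Pi1Computable (x : ℝ) : Prop :=
  ∃ f : ℕ → ℚ, Computable f ∧ Antitone f ∧
    Tendsto (fun n => (f n : ℝ)) atTop (nhds x)

/-- A computable real number. -/
def IsComputableReal (x : ℝ) : Prop :=
  ∃ f : ℕ → ℚ, Computable f ∧ ∀ n : ℕ, |(f n : ℝ) - x| ≤ (2 : ℝ) ^ (-(n : ℤ))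

/-- `w` is a finite concatenation of copies of `w₁` and `w₂`. -/
def IsConcat {A : Type*} (w₁ w₂ w : List A) : Prop :=
  ∃ L : List (List A), (∀ v ∈ L, v = w₁ ∨ v = w₂) ∧ w = L.flatten

/-- Transitivity of a one-dimensional subshift. -/
def Transitive1 {A : Type*} (H : Set (ℤ → A)) : Prop :=
  ∀ u w : List A, wordIn H u → wordIn H w → ∃ v : List A, wordIn H (u ++ v ++ w)

/-- The subshift of elements of `H` avoiding the word `u`. -/
def avoidWord {A : Type*} (H : Set (ℤ → A)) (u : List A) : Set (ℤ → A) :=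
  {x ∈ H | ¬ occursIn1 u x}


/-! ### Walks of prescribed length -/

/-- `NWalk E k a b`: there is a walk of length `k` from `a` to `b` in the digraph `E`. -/
def NWalk {α : Type*} (E : α → α → Prop) : ℕ → α → α → Prop
  | 0 => fun a b => a = b
  | k + 1 => fun a b => ∃ c, NWalk E k a c ∧ E c b

section NWalk

variable {α : Type*} {E : α → α → Prop}

lemma nwalk_one {x y : α} : NWalk E 1 x y ↔ E x y := by
  simp [NWalk]

lemma nwalk_add {a b : ℕ} {x z : α} :
    NWalk E (a + b) x z ↔ ∃ y, NWalk E a x y ∧ NWalk E b y z := by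
  induction b generalizing z with
  | zero => simp [NWalk]
  | succ b ih =>
    rw [← add_assoc]
    constructor
    · rintro ⟨c, hc, hcz⟩
      obtain ⟨y, h1, h2⟩ := ih.1 hc
      exact ⟨y, h1, c, h2, hcz⟩
    · rintro ⟨y, h1, c, h2, hcz⟩
      exact ⟨c, ih.2 ⟨y, h1, h2⟩, hcz⟩

lemma NWalk.trans {a b : ℕ} {x y z : α} (h : NWalk E a x y) (h' : NWalk E b y z) :
    NWalk E (a + b) x z :=
  nwalk_add.2 ⟨y, h, h'⟩

lemma NWalk.mono {F : α → α → Prop} (hEF : ∀ x y, E x y → F x y) {k : ℕ} {x y : α}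
    (h : NWalk E k x y) : NWalk F k x y := by
  induction k generalizing y with
  | zero => exact h
  | succ k ih =>
    obtain ⟨c, hc, hcy⟩ := h
    exact ⟨c, ih hc, hEF _ _ hcy⟩

lemma nwalk_mul {a b : ℕ} {x y : α} :
    NWalk E (a * b) x y ↔ NWalk (NWalk E a) b x y := by
  induction b generalizing y with
  | zero => simp [NWalk]
  | succ b ih =>
    rw [Nat.mul_succ, nwalk_add]
    simp only [ih]
    rfl

lemma nwalk_flip {k : ℕ} {x y : α} : NWalk (flip E) k x y ↔ NWalk E k y x := by
  induction k generalizing y with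
  | zero => simp [NWalk, eq_comm]
  | succ k ih =>
    rw [add_comm k 1, nwalk_add (E := E), add_comm 1 k]
    simp only [nwalk_one]
    exact exists_congr fun c => by rw [ih, and_comm]; rfl

lemma NWalk.loop {k : ℕ} {x : α} (h : NWalk E k x x) (j : ℕ) : NWalk E (j * k) x x := by
  induction j with
  | zero => simp [NWalk]
  | succ j ih =>
    rw [Nat.succ_mul]
    exact ih.trans h

lemma NWalk.exists_fun {k : ℕ} {x y : α} (h : NWalk E k x y) :
    ∃ u : ℕ → α, u 0 = x ∧ u k = y ∧ ∀ i < k, E (u i) (u (i + 1)) := by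
  induction k generalizing y with
  | zero => exact ⟨fun _ => x, rfl, h, by simp⟩
  | succ k ih =>
    obtain ⟨c, hc, hcy⟩ := h
    obtain ⟨u, h0, hk, hu⟩ := ih hc
    refine ⟨fun i => if i ≤ k then u i else y, by simp [h0], by simp, fun i hi => ?_⟩
    rcases Nat.lt_succ_iff_lt_or_eq.1 hi with hi' | rfl
    · simpa [hi'.le, Nat.succ_le_of_lt hi'] using hu i hi'
    · simpa [hk] using hcy

lemma exists_nwalk_of_transGen {x y : α} (h : Relation.TransGen E x y) :
    ∃ k, 0 < k ∧ NWalk E k x y := by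
  induction h with
  | single h => exact ⟨1, one_pos, nwalk_one.2 h⟩
  | tail _ h ih =>
    obtain ⟨k, _, hk⟩ := ih
    exact ⟨k + 1, k.succ_pos, _, hk, h⟩

/-- Closed walks of length `m`, parametrised by `ZMod m`. -/
def IsCyc (E : α → α → Prop) {m : ℕ} (u : ZMod m → α) : Prop :=
  ∀ i, E (u i) (u (i + 1))

lemma IsCyc.rotate {m : ℕ} {u : ZMod m → α} (h : IsCyc E u) (t : ZMod m) :
    IsCyc E fun i => u (i + t) := fun i => by
  simpa [add_right_comm] using h (i + t)

lemma NWalk.exists_isCyc {m k : ℕ} (hk : k < m) {x y : α}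
    (h : NWalk E k x y) (h' : NWalk E (m - k) y x) :
    ∃ u : ZMod m → α, IsCyc E u ∧ u 0 = x ∧ u k = y := by
  obtain ⟨u, hu0, huk, hu⟩ := h.exists_fun
  obtain ⟨w, hw0, hwm, hw⟩ := h'.exists_fun
  have : NeZero m := ⟨by omega⟩
  set g : ℕ → α := fun i => if i ≤ k then u i else w (i - k) with hg
  have hgE : ∀ i < m, E (g i) (g (i + 1)) := by
    intro i hi
    rcases lt_trichotomy i k with hik | rfl | hik
    · simpa [hg, hik.le, Nat.succ_le_of_lt hik] using hu i hik
    · have := hw 0 (by omega)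
      simpa [hg, huk, hw0] using this
    · have := hw (i - k) (by omega)
      rw [show i - k + 1 = i + 1 - k by omega] at this
      simpa [hg, not_le.2 hik, not_le.2 (hik.trans i.lt_succ_self)] using this
  have hgm : g m = g 0 := by simp [hg, hk, hwm, hu0]
  refine ⟨fun i => g i.val, fun i => ?_, by simp [hg, hu0], ?_⟩
  · change E (g i.val) (g (i + 1).val)
    have h1 := hgE i.val i.val_lt
    rcases (Nat.succ_le_of_lt i.val_lt).lt_or_eq with h2 | h2
    · have : (i + 1).val = i.val + 1 := by
        have h3 : ((i.val + 1 : ℕ) : ZMod m) = i + 1 := by simp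
        rw [← h3, ZMod.val_natCast_of_lt h2]
      rwa [this]
    · have : (i + 1).val = 0 := by
        have h3 : ((i.val + 1 : ℕ) : ZMod m) = 0 := by
          rw [show i.val + 1 = m from h2]; simp
        rw [Nat.cast_add, ZMod.natCast_zmod_val, Nat.cast_one] at h3
        simp [h3]
      rw [this, ← hgm]
      rwa [show i.val + 1 = m from h2] at h1
  · simp [ZMod.val_natCast_of_lt hk, hg, huk]

end NWalk

/-! ### Irreducible digraphs with an eventual period -/

/-- An irreducible digraph whose walk relations are periodic of period `M` from `M` on. -/
structure IsIrredPeriodic {α : Type*} (E : α → α → Prop) (M : ℕ) : Prop where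
  pos : 0 < M
  per : ∀ k, M ≤ k → ∀ x y, NWalk E (k + M) x y ↔ NWalk E k x y
  loop : ∀ x, NWalk E M x x
  conn : ∀ x y, ∃ k, NWalk E k x y

/-- Every walk of length `M + 1` can be shortcut to an edge. -/
def HasShortcuts {α : Type*} (E : α → α → Prop) (M : ℕ) : Prop :=
  ∀ x y, NWalk E (M + 1) x y → E x y

lemma exists_isIrredPeriodic {α : Type*} [Finite α] {E : α → α → Prop}
    (h : ∀ x y, Relation.TransGen E x y) : ∃ M, IsIrredPeriodic E M := by
  obtain ⟨a, b, hab, heq⟩ : ∃ a b, a < b ∧ NWalk E a = NWalk E b := by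
    obtain ⟨a, b, hne, heq⟩ := Finite.exists_ne_map_eq_of_infinite (NWalk E)
    rcases hne.lt_or_gt with h | h
    exacts [⟨a, b, h, heq⟩, ⟨b, a, h, heq.symm⟩]
  obtain ⟨P, rfl⟩ : ∃ P, b = a + P := ⟨b - a, by omega⟩
  have h1 : ∀ k, a ≤ k → ∀ x y, NWalk E (k + P) x y ↔ NWalk E k x y := by
    intro k hk x y
    obtain ⟨j, rfl⟩ := Nat.exists_eq_add_of_le hk
    rw [add_right_comm, nwalk_add, nwalk_add, ← heq]
  have h2 : ∀ j k, a ≤ k → ∀ x y, NWalk E (k + P * j) x y ↔ NWalk E k x y := by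
    intro j
    induction j with
    | zero => simp
    | succ j ih =>
      intro k hk x y
      rw [Nat.mul_succ, ← add_assoc, h1 _ (by omega), ih k hk]
  have hM : a ≤ P * (a + 1) := by nlinarith
  refine ⟨P * (a + 1), Nat.mul_pos (by omega) a.succ_pos, fun k hk => h2 _ k (hM.trans hk), fun x => ?_,
    fun x y => (exists_nwalk_of_transGen (h x y)).imp fun _ => And.right⟩
  obtain ⟨l, hl, hx⟩ := exists_nwalk_of_transGen (h x x)
  have h3 := hx.loop (P * (a + 1))
  obtain ⟨l, rfl⟩ := Nat.exists_eq_add_of_le' hl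
  rw [Nat.mul_succ, add_comm, mul_assoc, h2 _ _ hM] at h3
  exact h3

namespace IsIrredPeriodic

variable {α : Type*} {E : α → α → Prop} {M : ℕ}

lemma nwalk_congr (hE : IsIrredPeriodic E M) {k l : ℕ} (hk : M ≤ k) (hl : M ≤ l)
    (hkl : k ≡ l [MOD M]) {x y : α} : NWalk E k x y ↔ NWalk E l x y := by
  have key : ∀ j k, M ≤ k → (NWalk E (k + M * j) x y ↔ NWalk E k x y) := by
    intro j
    induction j with
    | zero => simp
    | succ j ih =>
      intro k hk
      rw [Nat.mul_succ, ← add_assoc, hE.per _ (by omega), ih k hk]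
  rcases le_total k l with h | h
  · obtain ⟨j, hj⟩ := (Nat.modEq_iff_dvd' h).1 hkl
    rw [show l = k + M * j by omega, key _ _ hk]
  · obtain ⟨j, hj⟩ := (Nat.modEq_iff_dvd' h).1 hkl.symm
    rw [show k = l + M * j by omega, key _ _ hl]

/-- Walks can be reversed, up to a length that is correct modulo `M`. -/
lemma nwalk_return (hE : IsIrredPeriodic E M) {k l : ℕ} {x y : α} (h : NWalk E k x y)
    (hkl : M ∣ k + l) (hl : M ≤ l) : NWalk E l y x := by
  obtain ⟨s, hs⟩ := hE.conn y x
  have h1 : NWalk E (s + (M - 1) * (k + s) + M) y x :=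
    (hs.trans ((h.trans hs).loop (M - 1))).trans (hE.loop x)
  refine (hE.nwalk_congr (Nat.le_add_left _ _) hl ?_).1 h1
  refine Nat.ModEq.add_left_cancel' k ?_
  refine Nat.ModEq.trans ?_ ((Nat.modEq_zero_iff_dvd.2 hkl).symm)
  rw [Nat.modEq_zero_iff_dvd]
  obtain ⟨N, rfl⟩ := Nat.exists_eq_succ_of_ne_zero hE.pos.ne'
  refine ⟨k + s + 1, ?_⟩
  simp only [Nat.succ_eq_add_one, Nat.add_sub_cancel]
  ring

lemma nwalk_class (hE : IsIrredPeriodic E M) {a b : ℕ} (ha : M ≤ a)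
    {x y z : α} (hay : NWalk E a x y) (hby : NWalk E b x y) (hbz : NWalk E b x z) :
    NWalk E a x z := by
  have hl : NWalk E (M * (b + 1) - b) y x := by
    have := hE.pos
    have : b + M ≤ M * (b + 1) := by nlinarith
    exact hE.nwalk_return hby ⟨b + 1, by omega⟩ (by omega)
  have h1 := (hay.trans hl).trans hbz
  refine (hE.nwalk_congr (by omega) ha ?_).1 h1
  have : b ≤ M * (b + 1) := by have := hE.pos; nlinarith
  rw [show a + (M * (b + 1) - b) + b = a + M * (b + 1) by omega]
  simp [Nat.ModEq]

lemma flip (hE : IsIrredPeriodic E M) : IsIrredPeriodic (flip E) M where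
  pos := hE.pos
  per k hk x y := by simpa [nwalk_flip] using hE.per k hk y x
  loop x := by simpa [nwalk_flip] using hE.loop x
  conn x y := by simpa [nwalk_flip] using hE.conn y x

lemma nwalk_succ_of_edge (hE : IsIrredPeriodic E M) {x y : α} (h : E x y) :
    NWalk E (M + 1) x y :=
  (hE.loop x).trans (nwalk_one.2 h)

lemma exists_nwalk (hE : IsIrredPeriodic E M) (k : ℕ) (x : α) : ∃ y, NWalk E k x y := by
  have h := (hE.loop x).loop k
  have hk : k ≤ k * M := Nat.le_mul_of_pos_right k hE.pos
  rw [← Nat.add_sub_cancel' hk, nwalk_add] at h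
  exact h.imp fun _ => And.left

/-- If walks of some length `k ≥ 2` can all be shortcut, then the digraph is complete. -/
lemma hasShortcuts_of_nwalk_imp (hE : IsIrredPeriodic E M) {k : ℕ} (hk : 2 ≤ k)
    (h : ∀ x y, NWalk E k x y → E x y) : HasShortcuts E M := by
  have hpow : ∀ t x y, NWalk E (k ^ t) x y → E x y := by
    intro t
    induction t with
    | zero => intro x y; simp [nwalk_one]
    | succ t ih =>
      intro x y hxy
      rw [pow_succ, nwalk_mul] at hxy
      exact h _ _ (hxy.mono ih)
  intro x z hz
  obtain ⟨y, hy⟩ := hE.exists_nwalk (k ^ M) x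
  exact hpow M _ _ (hE.nwalk_class (Nat.lt_pow_self hk).le hy
    (hE.nwalk_succ_of_edge (hpow M _ _ hy)) hz)

lemma hasShortcuts_of_nwalk_imp_swap (hE : IsIrredPeriodic E M) {k : ℕ} (hk : 2 ≤ k)
    (h : ∀ x y, NWalk E k x y → E y x) : HasShortcuts E M := by
  refine hE.hasShortcuts_of_nwalk_imp (k := k * k) (by nlinarith) fun x y hxy => ?_
  rw [nwalk_mul] at hxy
  exact h _ _ (nwalk_flip.1 (hxy.mono h))

lemma hasShortcuts_of_branch (hE : IsIrredPeriodic E M) {i : ℕ} (hi : 1 ≤ i)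
    (h : ∀ x a b, NWalk E i x a → NWalk E (i + 1) x b → E a b) : HasShortcuts E M := by
  have key : ∀ j, i ≤ j → ∀ x a b, NWalk E j x a → NWalk E (j + 1) x b → E a b := by
    intro j hj
    induction j, hj using Nat.le_induction with
    | base => exact h
    | succ j hj ih =>
      intro x a b hxa hxb
      obtain ⟨w, hxw, hwa⟩ := hxa
      obtain ⟨c, hxc, hcb⟩ := hxb
      have hwc := ih x w c hxw hxc
      obtain ⟨l, rfl⟩ := Nat.exists_eq_add_of_le' (hi.trans hj)
      rw [add_comm l 1, nwalk_add] at hxw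
      obtain ⟨y, -, hyw⟩ := hxw
      exact ih y a b ⟨w, hyw, hwa⟩ ⟨c, ⟨w, hyw, hwc⟩, hcb⟩
  intro x y hxy
  refine key (i * M) (Nat.le_mul_of_pos_right i hE.pos) x x y ((hE.loop x).loop i) ?_
  refine (hE.nwalk_congr (by omega) ?_ ?_).1 hxy
  · exact (Nat.le_mul_of_pos_left M hi).trans (Nat.le_succ _)
  · simp [Nat.ModEq]

/-- In a digraph that is not complete, two distinct positions of a long cycle that are not
consecutive can be filled by a non-edge. -/
lemma exists_isCyc_not_edge (hE : IsIrredPeriodic E M) (hc : ¬ HasShortcuts E M) {m k : ℕ}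
    (hm : M ∣ m) (hM : 2 * M ≤ m) (hk : 2 ≤ k) (hkm : k + 2 ≤ m) :
    ∃ u : ZMod m → α, IsCyc E u ∧ ¬ E (u 0) (u k) := by
  obtain ⟨x, y, hxy, hyx, hn⟩ : ∃ x y, NWalk E k x y ∧ NWalk E (m - k) y x ∧ ¬ E x y := by
    have hdvd : M ∣ k + (m - k) := by rwa [Nat.add_sub_cancel' (by omega)]
    by_cases hk' : k + M ≤ m
    · by_contra! H
      exact hc (hE.hasShortcuts_of_nwalk_imp hk fun x y hxy =>
        H x y hxy (hE.nwalk_return hxy hdvd (by omega)))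
    · by_contra! H
      refine hc (hE.hasShortcuts_of_nwalk_imp_swap (k := m - k) (by omega) fun x y hxy => ?_)
      exact H y x (hE.nwalk_return hxy (by rwa [add_comm]) (by omega)) hxy
  obtain ⟨u, hu, h0, h1⟩ := hxy.exists_isCyc (by omega) hyx
  exact ⟨u, hu, by rwa [h0, h1]⟩

/-- In a digraph that is not complete, two long cycles can branch from a common vertex and be
separated at any prescribed later step. -/
lemma exists_isCyc_branch (hE : IsIrredPeriodic E M) (hc : ¬ HasShortcuts E M) {m i : ℕ}
    (hm : M ∣ m) (hM : 2 * M ≤ m) (hi : 1 ≤ i) (him : i + 2 ≤ m) :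
    ∃ u w : ZMod m → α, IsCyc E u ∧ IsCyc E w ∧ u 0 = w 0 ∧ ¬ E (u i) (w (i + 1)) := by
  obtain ⟨x, a, b, hxa, hax, hxb, hbx, hn⟩ : ∃ x a b, NWalk E i x a ∧ NWalk E (m - i) a x ∧
      NWalk E (i + 1) x b ∧ NWalk E (m - (i + 1)) b x ∧ ¬ E a b := by
    have hd1 : M ∣ i + (m - i) := by rwa [Nat.add_sub_cancel' (by omega)]
    have hd2 : M ∣ (i + 1) + (m - (i + 1)) := by rwa [Nat.add_sub_cancel' (by omega)]
    by_cases hi' : i + 1 + M ≤ m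
    · by_contra! H
      exact hc (hE.hasShortcuts_of_branch hi fun x a b hxa hxb =>
        H x a b hxa (hE.nwalk_return hxa hd1 (by omega)) hxb
          (hE.nwalk_return hxb hd2 (by omega)))
    · by_contra! H
      have hfl : HasShortcuts (_root_.flip E) M := by
        refine hE.flip.hasShortcuts_of_branch (i := m - (i + 1)) (by omega) fun x b a hb ha => ?_
        rw [nwalk_flip] at hb ha
        rw [show m - (i + 1) + 1 = m - i by omega] at ha
        exact H x a b (hE.nwalk_return ha (by rwa [add_comm]) (by omega)) ha
          (hE.nwalk_return hb (by rwa [add_comm]) (by omega)) hb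
      exact hc fun x y hxy => hfl y x (nwalk_flip.2 hxy)
  obtain ⟨u, hu, hu0, hui⟩ := hxa.exists_isCyc (by omega) hax
  obtain ⟨w, hw, hw0, hwi⟩ := hxb.exists_isCyc (by omega) hbx
  refine ⟨u, w, hu, hw, by rw [hu0, hw0], ?_⟩
  rw [hui]
  push_cast at hwi
  rwa [hwi]

/-- A complete irreducible digraph is a state-split cycle. -/
lemma exists_phase (hE : IsIrredPeriodic E M) (hc : HasShortcuts E M) (x₀ : α) :
    ∃ p : ℕ, 0 < p ∧ ∃ f : α → ZMod p, (∀ i, ∃ v, f v = i) ∧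
      ∀ v w, E v w ↔ f w = f v + 1 := by
  classical
  have hex : ∃ p, 0 < p ∧ NWalk E (M + p) x₀ x₀ :=
    ⟨M, hE.pos, (hE.loop x₀).trans (hE.loop x₀)⟩
  set p := Nat.find hex with hp
  obtain ⟨hp0, hpw⟩ : 0 < p ∧ NWalk E (M + p) x₀ x₀ := Nat.find_spec hex
  have hshift : ∀ {t t' : ℕ} {x y : α}, t ≡ t' [MOD M] →
      (NWalk E (M + t) x y ↔ NWalk E (M + t') x y) := fun h =>
    hE.nwalk_congr (by omega) (by omega) (h.add_left M)
  have hadd : ∀ {t t' : ℕ} {x y z : α}, NWalk E (M + t) x y → NWalk E (M + t') y z →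
      NWalk E (M + (t + t')) x z := by
    intro t t' x y z h h'
    refine (hE.nwalk_congr (by omega) (by omega) ?_).1 (h.trans h')
    rw [show M + t + (M + t') = (M + (t + t')) + M by ring]
    simp [Nat.ModEq]
  have hmul : ∀ k, NWalk E (M + k * p) x₀ x₀ := by
    intro k
    induction k with
    | zero => simpa using hE.loop x₀
    | succ k ih => rw [Nat.succ_mul]; exact hadd ih hpw
  have hdvd : ∀ t, NWalk E (M + t) x₀ x₀ → p ∣ t := by
    intro t ht
    rw [Nat.dvd_iff_mod_eq_zero]
    by_contra hr
    have hmin := Nat.find_min hex (Nat.mod_lt t hp0)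
    refine hmin ⟨Nat.pos_of_ne_zero hr, ?_⟩
    have h1 := hadd ht (hmul ((M - 1) * (t / p)))
    refine (hshift ?_).1 h1
    obtain ⟨N, hN⟩ := Nat.exists_eq_succ_of_ne_zero hE.pos.ne'
    have h2 : t + (M - 1) * (t / p) * p = t % p + M * (t / p * p) := by
      have h3 := Nat.mod_add_div t p
      rw [hN, Nat.succ_sub_one]
      calc t + N * (t / p) * p = (t % p + p * (t / p)) + N * (t / p) * p := by rw [h3]
        _ = _ := by rw [Nat.succ_eq_add_one]; ring
    rw [h2]
    change _ % M = t % p % M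
    simp
  have hto : ∀ y, ∃ t, NWalk E (M + t) x₀ y := fun y =>
    (hE.conn x₀ y).imp fun _ h => (hE.loop x₀).trans h
  have hfrom : ∀ y, ∃ t, NWalk E (M + t) y x₀ := fun y =>
    (hE.conn y x₀).imp fun _ h => (hE.loop y).trans h
  choose t ht using hto
  choose s hs using hfrom
  have hts : ∀ y, ((t y : ℕ) : ZMod p) + (s y : ℕ) = 0 := by
    intro y
    have := (ZMod.natCast_eq_zero_iff _ _).2 (hdvd _ (hadd (ht y) (hs y)))
    exact_mod_cast this
  have huniq : ∀ y t', NWalk E (M + t') x₀ y → ((t' : ℕ) : ZMod p) = t y := by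
    intro y t' h'
    have := (ZMod.natCast_eq_zero_iff _ _).2 (hdvd _ (hadd h' (hs y)))
    push_cast at this
    exact add_right_cancel (this.trans (hts y).symm)
  refine ⟨p, hp0, fun y => (t y : ZMod p), fun i => ?_, fun v w => ⟨fun h => ?_, fun h => ?_⟩⟩
  · obtain ⟨y, hy⟩ := hE.exists_nwalk (M + i.val) x₀
    have : NeZero p := ⟨hp0.ne'⟩
    exact ⟨y, (huniq y _ hy).symm.trans (by simp)⟩
  · have := huniq w (t v + 1) ⟨v, ht v, h⟩
    rw [Nat.cast_succ] at this
    exact this.symm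
  · have h1 : (((s v + t w : ℕ) : ℤ) : ZMod p) = ((1 : ℤ) : ZMod p) := by
      have := hts v
      change (t w : ZMod p) = t v + 1 at h
      push_cast
      rw [h, ← add_assoc, add_comm (s v : ZMod p), this, zero_add]
    have h2 : ((p : ℕ) : ℤ) ∣ 1 - ((s v + t w : ℕ) : ℤ) :=
      (ZMod.intCast_eq_intCast_iff_dvd_sub _ _ _).1 h1
    obtain ⟨k, hk⟩ : ∃ k : ℕ, s v + k * p + t w ≡ 1 [MOD M] := by
      obtain ⟨c, hc⟩ := h2
      refine ⟨(c % M).toNat, ?_⟩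
      have hcM : ((c % M).toNat : ℤ) = c % M :=
        Int.toNat_of_nonneg (Int.emod_nonneg _ (by have := hE.pos; omega))
      rw [← Int.natCast_modEq_iff]
      push_cast at hc ⊢
      rw [hcM]
      have h4 : c % M ≡ c [ZMOD M] := Int.mod_modEq c M
      have h5 := ((h4.mul_right (p : ℤ)).add_left (s v : ℤ)).add_right (t w : ℤ)
      rw [show (s v : ℤ) + c * p + t w = 1 by linarith] at h5
      exact h5
    exact hc v w ((hshift hk).1 (hadd (hadd (hs v) (hmul k)) (ht w)))

end IsIrredPeriodic

/-! ### Cycles provided by the failure of condition D -/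

section ConditionD

variable {A : Type*} {E : A → A → Prop} {S : Set A}

lemma IsSCC.mem_of_transGen (hS : IsSCC E S) {a c : A} (ha : a ∈ S)
    (hac : Relation.TransGen E a c) (hca : Relation.TransGen E c a) : c ∈ S := by
  have h := hS.2.2 {c | Relation.TransGen E a c ∧ Relation.TransGen E c a}
    (fun b hb => ⟨hS.2.1 a ha b hb, hS.2.1 b hb a ha⟩)
    (fun b hb d hd => hb.2.trans hd.1)
  rw [← h]
  exact ⟨hac, hca⟩

lemma IsSCC.transGen_restrict (hS : IsSCC E S) (a b : S) :
    Relation.TransGen (fun x y : S => E x y) a b := by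
  have key : ∀ c, Relation.TransGen E (a : A) c → Relation.TransGen E c (a : A) →
      ∀ hc : c ∈ S, Relation.TransGen (fun x y : S => E x y) a ⟨c, hc⟩ := by
    intro c hac
    induction hac with
    | single h => exact fun _ _ => .single h
    | tail hab h ih =>
      intro hca _
      have hba := Relation.TransGen.head h hca
      exact (ih hba (hS.mem_of_transGen a.2 hab hba)).tail h
  exact key b (hS.2.1 _ a.2 _ b.2) (hS.2.1 _ b.2 _ a.2) b.2

lemma IsSCC.exists_not_hasShortcuts [Finite A] (hS : IsSCC E S) (hns : ¬ StateSplitType E S) :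
    ∃ M, IsIrredPeriodic (fun x y : S => E x y) M ∧
      ¬ HasShortcuts (fun x y : S => E x y) M := by
  classical
  obtain ⟨M, hM⟩ := exists_isIrredPeriodic hS.transGen_restrict
  refine ⟨M, hM, fun hc => hns ?_⟩
  obtain ⟨x₀, hx₀⟩ := hS.1
  obtain ⟨p, hp, f, hsurj, hf⟩ := hM.exists_phase hc ⟨x₀, hx₀⟩
  refine ⟨p, hp, fun a => if h : a ∈ S then f ⟨a, h⟩ else 0, fun i => ?_, fun v hv w hw => ?_⟩
  · obtain ⟨⟨v, hv⟩, rfl⟩ := hsurj i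
    exact ⟨v, hv, by simp [hv]⟩
  · simpa [hv, hw] using hf ⟨v, hv⟩ ⟨w, hw⟩

/-- The closed walks used in the construction: for some length `m`, any two non-consecutive
positions can be filled by a non-edge, and two closed walks with a common vertex can be separated
at any step that avoids the common position. -/
structure HasCycles (E : A → A → Prop) (m : ℕ) : Prop where
  four_le : 4 ≤ m
  not_edge : ∀ k : ZMod m, k ≠ 1 → ∃ u : ZMod m → A, IsCyc E u ∧ ¬ E (u 0) (u k)
  branch : ∀ i : ZMod m, i ≠ 0 → i + 1 ≠ 0 → ∃ u w : ZMod m → A, IsCyc E u ∧ IsCyc E w ∧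
    u 0 = w 0 ∧ ¬ E (u i) (w (i + 1))

lemma exists_hasCycles [Finite A] (hD : ¬ ConditionD E) : ∃ m, HasCycles E m := by
  simp only [ConditionD, not_or, not_forall] at hD
  obtain ⟨⟨S₁, hS₁, hr⟩, ⟨S₂, hS₂, hs⟩, ⟨S₃, hS₃, hn⟩⟩ := hD
  simp only [ReflexiveType, SymmetricType, not_forall] at hr hs
  obtain ⟨v, hv, hvv⟩ := hr
  obtain ⟨a, ha, b, hb, -, hab, hba⟩ := hs
  obtain ⟨l₁, hl₁, hw₁⟩ := exists_nwalk_of_transGen (hS₁.2.1 v hv v hv)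
  obtain ⟨l₂, -, hw₂⟩ := exists_nwalk_of_transGen (hS₂.2.1 b hb a ha)
  obtain ⟨M, hM, hc⟩ := hS₃.exists_not_hasShortcuts hn
  have hMpos := hM.pos
  obtain ⟨m, hm⟩ : ∃ m, m = 4 * (l₁ * ((l₂ + 1) * M)) := ⟨_, rfl⟩
  have hMm : M ∣ m := ⟨4 * (l₁ * (l₂ + 1)), by rw [hm]; ring⟩
  have hcpos : 0 < l₁ * (l₂ + 1) := by positivity
  have h4M : 4 * M ≤ m := by
    rw [hm]
    calc 4 * M ≤ 4 * (l₁ * (l₂ + 1)) * M := by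
          exact Nat.mul_le_mul_right _ (by omega)
      _ = _ := by ring
  have h4 : 4 ≤ m := by omega
  have : NeZero m := ⟨by omega⟩
  have : Fact (1 < m) := ⟨by omega⟩
  have hval : ∀ k : ZMod m, ((k.val : ℕ) : ZMod m) = k := fun k => by simp
  have hvalm : ((m - 1 : ℕ) : ZMod m) = -1 := by
    rw [Nat.cast_sub (by omega)]; simp
  have hcoe : ∀ {u : ZMod m → S₃}, IsCyc (fun x y : S₃ => E x y) u →
      IsCyc E fun i => (u i : A) := fun h i => h i
  refine ⟨m, h4, fun k hk => ?_, fun i hi hi' => ?_⟩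
  · by_cases hk0 : k = 0
    · have h1 : NWalk E (m - 0) v v := by
        rw [Nat.sub_zero, hm, show 4 * (l₁ * ((l₂ + 1) * M)) = 4 * ((l₂ + 1) * M) * l₁ by ring]
        exact hw₁.loop _
      obtain ⟨u, hu, h0, -⟩ := NWalk.exists_isCyc (k := 0) (by omega) rfl h1
      exact ⟨u, hu, by rwa [hk0, h0]⟩
    by_cases hk1 : k = -1
    · have h1 : NWalk E (m - 1) b a := by
        obtain ⟨c, hcm⟩ : ∃ c, m = (c + 1) * (l₂ + 1) := by
          refine ⟨4 * (l₁ * M) - 1, ?_⟩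
          have : 0 < 4 * (l₁ * M) := by positivity
          rw [Nat.sub_add_cancel this, hm]
          ring
        have h2 : m - 1 = l₂ + c * (1 + l₂) := by rw [hcm, add_comm l₂ 1, add_mul]; omega
        rw [h2]
        exact hw₂.trans (((nwalk_one.2 hab).trans hw₂).loop c)
      obtain ⟨u, hu, h0, h1⟩ := NWalk.exists_isCyc (by omega) (nwalk_one.2 hab) h1
      refine ⟨_, hu.rotate 1, ?_⟩
      simp only [hk1, zero_add, neg_add_cancel, h0]
      rw [Nat.cast_one] at h1
      rwa [h1]
    · have hne : ∀ j : ℕ, (j : ZMod m) ≠ k → k.val ≠ j := by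
        rintro j hj rfl
        exact hj (hval k)
      have hv0 := hne 0 (by simpa using Ne.symm hk0)
      have hv1 := hne 1 (by simpa using hk.symm)
      have hvm := hne (m - 1) (by rw [hvalm]; exact Ne.symm hk1)
      have hlt := k.val_lt
      obtain ⟨u, hu, hn⟩ := hM.exists_isCyc_not_edge hc hMm (by omega) (k := k.val) (by omega)
        (by omega)
      rw [hval] at hn
      exact ⟨_, hcoe hu, hn⟩
  · have hv0 : i.val ≠ 0 := by simpa using hi
    have hvm : i.val ≠ m - 1 := by
      intro h
      apply hi'
      rw [← hval i, h, hvalm, neg_add_cancel]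
    have hlt := i.val_lt
    obtain ⟨u, w, hu, hw, h0, hn⟩ := hM.exists_isCyc_branch hc hMm (by omega) (i := i.val)
      (by omega) (by omega)
    rw [hval] at hn
    exact ⟨_, _, hcoe hu, hcoe hw, congrArg Subtype.val h0, hn⟩

end ConditionD

/-! ### A cyclic sequence containing every pair at every distance -/

lemma exists_pairs_nat {M : ℕ} (hM : 0 < M) : ∃ n, 1 < n ∧ ∃ g : ℕ → ℕ,
    ∀ d, 0 < d → 2 * d ≤ n → ∀ a < M, ∀ b < M, ∃ r, r + d < n ∧ g r = a ∧ g (r + d) = b := by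
  obtain ⟨L, hL⟩ : ∃ L, L = M * M + 1 := ⟨_, rfl⟩
  obtain ⟨K, hK⟩ : ∃ K, K = M * M * L := ⟨_, rfl⟩
  have hMM : 0 < M * M := by positivity
  refine ⟨2 * (K + M * M), by omega, fun r =>
    if r < K then (if r % L = 0 then r / L / M else r / L % M)
    else if r < K + M * M then (r - K) / M else r % M, fun d hd hdn a ha b hb => ?_⟩
  by_cases hdL : d < L
  · have he : a * M + b < M * M := by nlinarith
    have hr : L * (a * M + b) + d < K := by
      have : L * (a * M + b + 1) ≤ L * (M * M) := Nat.mul_le_mul_left _ he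
      rw [hK, mul_comm (M * M) L]
      linarith
    have h1 : (a * M + b) / M = a := by
      rw [mul_comm, Nat.mul_add_div hM, Nat.div_eq_of_lt hb, add_zero]
    have h2 : (a * M + b) % M = b := by
      rw [mul_comm, Nat.mul_add_mod, Nat.mod_eq_of_lt hb]
    refine ⟨L * (a * M + b), by omega, ?_, ?_⟩
    · beta_reduce
      rw [if_pos (by omega), if_pos (Nat.mul_mod_right _ _), Nat.mul_div_cancel_left _ (by omega),
        h1]
    · beta_reduce
      rw [if_pos hr, Nat.mul_add_mod, Nat.mod_eq_of_lt hdL, if_neg hd.ne',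
        Nat.mul_add_div (by omega), Nat.div_eq_of_lt hdL, add_zero, h2]
  · obtain ⟨t, ht, htb⟩ : ∃ t < M, (K + a * M + d + t) % M = b := by
      refine ⟨(b + (M - (K + a * M + d) % M)) % M, Nat.mod_lt _ hM, ?_⟩
      have h1 := Nat.mod_add_div (K + a * M + d) M
      have h2 := Nat.mod_lt (K + a * M + d) hM
      rw [Nat.add_mod_mod, show K + a * M + d + (b + (M - (K + a * M + d) % M)) =
        b + M + M * ((K + a * M + d) / M) by omega, Nat.add_mul_mod_self_left, Nat.add_mod_right,
        Nat.mod_eq_of_lt hb]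
    have haM : a * M + t < M * M := by nlinarith
    refine ⟨K + (a * M + t), by omega, ?_, ?_⟩
    · beta_reduce
      rw [if_neg (by omega), if_pos (by omega), Nat.add_sub_cancel_left, mul_comm,
        Nat.mul_add_div hM, Nat.div_eq_of_lt ht, add_zero]
    · beta_reduce
      rw [if_neg (by omega), if_neg (by omega), ← htb]
      congr 1
      ring

lemma exists_pairs (Ω : Type*) [Finite Ω] [Nonempty Ω] : ∃ n, 1 < n ∧ ∃ h : ZMod n → Ω,
    ∀ d ≠ 0, ∀ a b, ∃ r, h r = a ∧ h (r + d) = b := by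
  classical
  obtain ⟨M, ⟨e⟩⟩ := Finite.exists_equiv_fin Ω
  have hM : 0 < M := Fin.pos (e (Classical.arbitrary Ω))
  obtain ⟨n, hn, g, hg⟩ := exists_pairs_nat hM
  have : NeZero n := ⟨by omega⟩
  have key : ∀ d : ZMod n, d ≠ 0 → 2 * d.val ≤ n → ∀ a b : Ω, ∃ r : ZMod n,
      g r.val = e a ∧ g (r + d).val = e b := by
    intro d hd hdn a b
    have hd0 : d.val ≠ 0 := by simpa using hd
    obtain ⟨r, hr, h1, h2⟩ := hg d.val (by omega) hdn _ (e a).2 _ (e b).2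
    refine ⟨r, by rwa [ZMod.val_natCast_of_lt (by omega)], ?_⟩
    have h3 : ((r : ZMod n) + d) = ((r + d.val : ℕ) : ZMod n) := by simp
    rwa [h3, ZMod.val_natCast_of_lt hr]
  have key' : ∀ d : ZMod n, d ≠ 0 → ∀ a b : Ω, ∃ r : ZMod n,
      g r.val = e a ∧ g (r + d).val = e b := by
    intro d hd a b
    by_cases hdn : 2 * d.val ≤ n
    · exact key d hd hdn a b
    · have : NeZero d := ⟨hd⟩
      obtain ⟨r, h1, h2⟩ := key (-d) (neg_ne_zero.2 hd) (by rw [ZMod.val_neg_of_ne_zero]; omega) b a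
      exact ⟨r + -d, h2, by simpa using h1⟩
  refine ⟨n, hn, fun r => if hr : g r.val < M then e.symm ⟨g r.val, hr⟩ else Classical.arbitrary Ω,
    fun d hd a b => ?_⟩
  obtain ⟨r, h1, h2⟩ := key' d hd a b
  refine ⟨r, ?_, ?_⟩
  · simp [h1]
  · simp [h2]

/-! ### The digraph of column states -/

/-- Column states. A state `(i, d, c)` lies in phase `i`; it carries the symbols `d` and `c`,
which must be equal except in phase `1`, where `(d, c)` must be an allowed horizontal transition. -/
def ColState {C : Type*} (ρ : C → C → Prop) (m : ℕ) : Type _ :=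
  {q : ZMod m × C × C // (q.1 = 1 → ρ q.2.1 q.2.2) ∧ (q.1 ≠ 1 → q.2.1 = q.2.2)}

namespace ColState

variable {C : Type*} {ρ : C → C → Prop} {m : ℕ}

/-- The phase of a column state. -/
def phase (q : ColState ρ m) : ZMod m := q.1.1

/-- The incoming symbol of a column state. -/
def src (q : ColState ρ m) : C := q.1.2.1

/-- The outgoing symbol of a column state. -/
def tgt (q : ColState ρ m) : C := q.1.2.2

lemma ext {q q' : ColState ρ m} (h : q.phase = q'.phase) (h₁ : q.src = q'.src)
    (h₂ : q.tgt = q'.tgt) : q = q' :=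
  Subtype.ext (Prod.ext h (Prod.ext h₁ h₂))

lemma rel (q : ColState ρ m) (h : q.phase = 1) : ρ q.src q.tgt := q.2.1 h

lemma src_eq_tgt (q : ColState ρ m) (h : q.phase ≠ 1) : q.src = q.tgt := q.2.2 h

/-- The state of phase `i` carrying twice the symbol `c`. -/
def diag (i : ZMod m) (hi : i ≠ 1) (c : C) : ColState ρ m :=
  ⟨(i, c, c), fun h => absurd h hi, fun _ => rfl⟩

/-- Horizontal transitions between column states. -/
def Adj (q q' : ColState ρ m) : Prop := q'.phase = q.phase + 1 ∧ q.tgt = q'.src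

/-- Assignments of vertices of `E` to column states that respect horizontal transitions. -/
def Row {A : Type*} (E : A → A → Prop) (ρ : C → C → Prop) (m : ℕ) : Type _ :=
  {f : ColState ρ m → A // ∀ q q', Adj q q' → E (f q) (f q')}

instance [Finite C] [NeZero m] : Finite (ColState ρ m) :=
  Subtype.finite

instance {A : Type*} [Finite A] [Finite C] [NeZero m] (E : A → A → Prop) :
    Finite (Row E ρ m) :=
  Subtype.finite

variable {A : Type*} {E : A → A → Prop}

/-- The row given by a closed walk. -/
def Row.ofCyc {u : ZMod m → A} (hu : IsCyc E u) : Row E ρ m :=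
  ⟨fun q => u q.phase, fun q q' h => by beta_reduce; rw [h.1]; exact hu _⟩

open Classical in
/-- The row choosing between two closed walks with a common vertex in phase `0`, according to
whether the outgoing symbol is `c`. -/
noncomputable def Row.ofTgt {u w : ZMod m → A} (hu : IsCyc E u) (hw : IsCyc E w)
    (h0 : u 0 = w 0) (c : C) : Row E ρ m :=
  ⟨fun q => if q.tgt = c then u q.phase else w q.phase, fun q q' h => by
    have key : ∀ {i : ZMod m}, i = 0 → u i = w i := by rintro _ rfl; exact h0
    beta_reduce
    by_cases hq : q.phase = 0
    · rw [key hq, ite_self, h.1]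
      split_ifs
      · rw [← key hq]; exact hu _
      · exact hw _
    · have h1 : q'.phase ≠ 1 := by rw [h.1]; simpa using hq
      rw [← q'.src_eq_tgt h1, ← h.2, h.1]
      split_ifs
      exacts [hu _, hw _]⟩

open Classical in
/-- The row choosing between two closed walks with a common vertex in phase `2`, according to
whether the incoming symbol is `c`. -/
noncomputable def Row.ofSrc {u w : ZMod m → A} (hu : IsCyc E u) (hw : IsCyc E w)
    (h0 : u 2 = w 2) (c : C) : Row E ρ m :=
  ⟨fun q => if q.src = c then u q.phase else w q.phase, fun q q' h => by
    have key : ∀ {i : ZMod m}, i = 1 → u (i + 1) = w (i + 1) := by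
      rintro _ rfl; rw [one_add_one_eq_two]; exact h0
    beta_reduce
    rw [h.1]
    by_cases hq : q.phase = 1
    · rw [key hq, ite_self]
      split_ifs
      · rw [← key hq]; exact hu _
      · exact hw _
    · rw [← h.2, ← q.src_eq_tgt hq]
      split_ifs
      exacts [hu _, hw _]⟩

/-- Rows detect all forbidden horizontal transitions. -/
lemma exists_row_not_edge (hm : HasCycles E m) {q q' : ColState ρ m} (h : ¬ Adj q q') :
    ∃ f : Row E ρ m, ¬ E (f.1 q) (f.1 q') := by
  have h4 := hm.four_le
  have hne : ∀ k : ℕ, 0 < k → k < 4 → ((k : ℕ) : ZMod m) ≠ 0 := by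
    intro k hk hk4
    rw [Ne, ZMod.natCast_eq_zero_iff]
    exact fun hd => absurd (Nat.le_of_dvd hk hd) (by omega)
  by_cases hp : q'.phase = q.phase + 1
  · have ht : q.tgt ≠ q'.src := fun ht => h ⟨hp, ht⟩
    by_cases hq : q.phase = 1 ∨ q.phase = 2
    · have h0 : q.phase ≠ 0 := by
        rcases hq with hq | hq <;> rw [hq]
        · exact_mod_cast hne 1 (by omega) (by omega)
        · exact_mod_cast hne 2 (by omega) (by omega)
      have h1 : q.phase + 1 ≠ 0 := by
        rcases hq with hq | hq <;> rw [hq]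
        · exact_mod_cast hne 2 (by omega) (by omega)
        · exact_mod_cast hne 3 (by omega) (by omega)
      obtain ⟨u, w, hu, hw, h00, hn⟩ := hm.branch q.phase h0 h1
      refine ⟨Row.ofTgt hu hw h00 q.tgt, ?_⟩
      have h2 : q'.src = q'.tgt := q'.src_eq_tgt (by rw [hp]; simpa using h0)
      simpa [Row.ofTgt, ← h2, ht.symm, hp] using hn
    · rw [not_or] at hq
      obtain ⟨u, w, hu, hw, h00, hn⟩ := hm.branch (q.phase - 2) (sub_ne_zero.2 hq.2) (by
        rw [show q.phase - 2 + 1 = q.phase - 1 by ring]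
        exact sub_ne_zero.2 hq.1)
      refine ⟨Row.ofSrc (hu.rotate (-2)) (hw.rotate (-2)) (by simpa using h00) q.src, ?_⟩
      rw [← q.src_eq_tgt hq.1] at ht
      rw [sub_add_eq_add_sub] at hn
      simpa [Row.ofSrc, ht.symm, hp, ← sub_eq_add_neg] using hn
  · obtain ⟨u, hu, hn⟩ := hm.not_edge (q'.phase - q.phase) (by
      rwa [Ne, sub_eq_iff_eq_add, add_comm])
    refine ⟨Row.ofCyc (hu.rotate (-q.phase)), ?_⟩
    simpa [Row.ofCyc, ← sub_eq_add_neg] using hn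

/-- Rows separate column states. -/
lemma eq_of_row_eq (hm : HasCycles E m) {q q' : ColState ρ m}
    (h : ∀ f : Row E ρ m, f.1 q = f.1 q') : q = q' := by
  have hout : ∀ p, Adj q p → Adj q' p := by
    intro p hp
    by_contra hn
    obtain ⟨f, hf⟩ := exists_row_not_edge hm hn
    exact hf (h f ▸ f.2 _ _ hp)
  have hin : ∀ p, Adj p q → Adj p q' := by
    intro p hp
    by_contra hn
    obtain ⟨f, hf⟩ := exists_row_not_edge hm hn
    exact hf (h f ▸ f.2 _ _ hp)
  have hout' : q.phase ≠ 0 → q'.phase = q.phase ∧ q'.tgt = q.tgt := by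
    intro h0
    obtain ⟨h1, h2⟩ := hout (diag (q.phase + 1) (by simpa using h0) q.tgt) ⟨rfl, rfl⟩
    exact ⟨(add_right_cancel h1).symm, h2⟩
  have hin' : q.phase ≠ 2 → q'.phase = q.phase ∧ q'.src = q.src := by
    intro h0
    obtain ⟨h1, h2⟩ := hin (diag (q.phase - 1)
      (by rwa [Ne, sub_eq_iff_eq_add, one_add_one_eq_two]) q.src) ⟨(sub_add_cancel _ _).symm, rfl⟩
    exact ⟨h1.trans (sub_add_cancel _ _), h2.symm⟩
  have h4 := hm.four_le
  have h10 : (1 : ZMod m) ≠ 0 := by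
    have : Fact (1 < m) := ⟨by omega⟩
    exact one_ne_zero
  have h20 : (2 : ZMod m) ≠ 0 := by
    rw [← Nat.cast_ofNat, Ne, ZMod.natCast_eq_zero_iff]
    exact fun hd => absurd (Nat.le_of_dvd two_pos hd) (by omega)
  by_cases h0 : q.phase = 0
  · obtain ⟨h1, h2⟩ := hin' (by rw [h0]; exact h20.symm)
    have h3 := q.src_eq_tgt (by rw [h0]; exact h10.symm)
    have h5 := q'.src_eq_tgt (by rw [h1, h0]; exact h10.symm)
    exact ext h1.symm h2.symm (by rw [← h3, ← h5, h2])
  by_cases hq2 : q.phase = 2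
  · obtain ⟨h1, h2⟩ := hout' h0
    have h21 : (2 : ZMod m) ≠ 1 := by rw [← one_add_one_eq_two]; simpa using h10
    have h3 := q.src_eq_tgt (by rwa [hq2])
    have h5 := q'.src_eq_tgt (by rwa [h1, hq2])
    exact ext h1.symm (by rw [h3, h5, h2]) h2.symm
  · exact ext (hout' h0).1.symm (hin' hq2).2.symm (hout' h0).2.symm

end ColState

/-! ### Columns encoding stacks of column states -/

namespace ColState

variable {A C : Type*} {E : A → A → Prop} {ρ vert : C → C → Prop} {m n : ℕ}

/-- A cyclic word `g` of length `n` of rows is synchronizing if column states and their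
horizontal transitions can be recovered from `g`, and shifted copies of `g` can neither agree
nor be horizontally adjacent. -/
structure IsSync (E : A → A → Prop) (g : ZMod n → ColState ρ m → A) : Prop where
  one_lt : 1 < n
  edge : ∀ r q q', Adj q q' → E (g r q) (g r q')
  adj : ∀ q q', (∀ r, E (g r q) (g r q')) → Adj q q'
  inj : ∀ q q', (∀ r, g r q = g r q') → q = q'
  exists_ne : ∀ d ≠ 0, ∀ i j : ZMod m, ∃ r, ∀ q q', q.phase = i → q'.phase = j →
    g r q ≠ g (r + d) q'
  exists_not_edge : ∀ d ≠ 0, ∀ i j : ZMod m, ∃ r, ∀ q q', q.phase = i → q'.phase = j →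
    ¬ E (g r q) (g (r + d) q')

lemma exists_isSync [Finite A] [Finite C] (hm : HasCycles E m) (ρ : C → C → Prop) :
    ∃ n, ∃ g : ZMod n → ColState ρ m → A, IsSync E g := by
  have h4 := hm.four_le
  have : NeZero m := ⟨by omega⟩
  have : Fact (1 < m) := ⟨by omega⟩
  obtain ⟨z, hz, hn⟩ := hm.not_edge 0 zero_ne_one
  have : Nonempty (Row E ρ m) := ⟨Row.ofCyc hz⟩
  obtain ⟨n, hn1, h, hh⟩ := exists_pairs (Row E ρ m)
  have : Fact (1 < n) := ⟨hn1⟩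
  have hsurj : ∀ f, ∃ r, h r = f := fun f => by
    obtain ⟨r, hr, -⟩ := hh 1 one_ne_zero f f
    exact ⟨r, hr⟩
  refine ⟨n, fun r => (h r).1, hn1, fun r => (h r).2, fun q q' H => ?_, fun q q' H => ?_,
    fun d hd i j => ?_, fun d hd i j => ?_⟩
  · by_contra hc
    obtain ⟨f, hf⟩ := exists_row_not_edge hm hc
    obtain ⟨r, rfl⟩ := hsurj f
    exact hf (H r)
  · refine eq_of_row_eq hm fun f => ?_
    obtain ⟨r, rfl⟩ := hsurj f
    exact H r
  · obtain ⟨r, h1, h2⟩ := hh d hd (Row.ofCyc (hz.rotate (-i))) (Row.ofCyc (hz.rotate (1 - j)))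
    refine ⟨r, fun q q' hq hq' he => hn ?_⟩
    have h01 : z 0 = z 1 := by simpa [h1, h2, Row.ofCyc, hq, hq'] using he
    have h3 := hz 0
    rw [zero_add, ← h01] at h3
    exact h3
  · obtain ⟨r, h1, h2⟩ := hh d hd (Row.ofCyc (hz.rotate (-i))) (Row.ofCyc (hz.rotate (-j)))
    refine ⟨r, fun q q' hq hq' he => hn ?_⟩
    simpa [h1, h2, Row.ofCyc, hq, hq'] using he

/-- Vertical compatibility in a sequence of column states. -/
def IsStack (vert : C → C → Prop) (Q : ℤ → ColState ρ m) : Prop :=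
  ∀ k, (Q (k + 1)).phase = (Q k).phase ∧
    ((Q k).phase = 0 → vert (Q k).tgt (Q (k + 1)).tgt)

lemma IsStack.phase_eq {Q : ℤ → ColState ρ m} (hQ : IsStack vert Q) (k : ℤ) :
    (Q k).phase = (Q 0).phase := by
  induction k using Int.induction_on with
  | zero => rfl
  | succ k ih => rw [(hQ _).1, ih]
  | pred k ih => rw [← ih, ← (hQ _).1, sub_add_cancel]

lemma IsStack.shift {Q : ℤ → ColState ρ m} (hQ : IsStack vert Q) (t : ℤ) :
    IsStack vert fun k => Q (k - t) := by
  intro k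
  have := hQ (k - t)
  rwa [sub_add_eq_add_sub] at this

/-- The column reading the states `Q`, one block of length `n` for each, starting at `s`. -/
def column (g : ZMod n → ColState ρ m → A) (s : ℤ) (Q : ℤ → ColState ρ m) : ℤ → A :=
  fun l => g ((l - s : ℤ) : ZMod n) (Q ((l - s) / n))

/-- The columns that read a stack of column states. -/
def columns (vert : C → C → Prop) (g : ZMod n → ColState ρ m → A) : Set (ℤ → A) :=
  {x | ∃ s Q, IsStack vert Q ∧ x = column g s Q}

lemma column_congr (hn : 0 < n) (g : ZMod n → ColState ρ m → A) {s s' : ℤ}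
    (h : ((s - s' : ℤ) : ZMod n) = 0) (Q : ℤ → ColState ρ m) :
    ∃ t : ℤ, column g s Q = column g s' fun k => Q (k - t) := by
  obtain ⟨t, ht⟩ := (ZMod.intCast_zmod_eq_zero_iff_dvd _ n).1 h
  refine ⟨t, funext fun l => ?_⟩
  have h1 : l - s = l - s' - n * t := by rw [← ht]; ring
  simp only [column]
  rw [h1, Int.sub_mul_ediv_left _ _ (by exact_mod_cast hn.ne')]
  simp

lemma exists_mem_window (hn : 0 < n) (l₀ : ℤ) (r : ZMod n) :
    ∃ l, l₀ ≤ l ∧ l < l₀ + n ∧ (l : ZMod n) = r := by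
  have : NeZero n := ⟨hn.ne'⟩
  refine ⟨l₀ + (r - l₀ : ZMod n).val, by omega, ?_, by simp⟩
  have := ZMod.val_lt (r - l₀ : ZMod n)
  omega

lemma exists_mem_block (hn : 0 < n) (s k : ℤ) (r : ZMod n) :
    ∃ l, s + k * n ≤ l ∧ l < s + k * n + n ∧ ((l - s : ℤ) : ZMod n) = r ∧ (l - s) / n = k := by
  obtain ⟨l, h1, h2, h3⟩ := exists_mem_window hn (s + k * n) (r + s)
  refine ⟨l, h1, h2, by simp [h3], ?_⟩
  rw [Int.ediv_eq_iff_of_pos (by exact_mod_cast hn)]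
  constructor <;> nlinarith

namespace IsSync

variable {g : ZMod n → ColState ρ m → A}

lemma pos (hg : IsSync E g) : 0 < n := by have := hg.one_lt; omega

lemma offset_eq_of_window (hg : IsSync E g) {s s' : ℤ} {Q Q' : ℤ → ColState ρ m}
    (hQ : IsStack vert Q) (hQ' : IsStack vert Q') (l₀ : ℤ)
    (h : ∀ l, l₀ ≤ l → l < l₀ + n → column g s Q l = column g s' Q' l) :
    ((s - s' : ℤ) : ZMod n) = 0 := by
  by_contra hd
  obtain ⟨r, hr⟩ := hg.exists_ne _ hd (Q 0).phase (Q' 0).phase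
  obtain ⟨l, h1, h2, h3⟩ := exists_mem_window hg.pos l₀ (r + s)
  refine hr _ _ (hQ.phase_eq ((l - s) / n)) (hQ'.phase_eq ((l - s') / n)) ?_
  have := h l h1 h2
  simpa [column, h3, add_sub_assoc] using this

lemma offset_eq_of_edge (hg : IsSync E g) {s s' : ℤ} {Q Q' : ℤ → ColState ρ m}
    (hQ : IsStack vert Q) (hQ' : IsStack vert Q')
    (h : ∀ l, E (column g s Q l) (column g s' Q' l)) :
    ((s - s' : ℤ) : ZMod n) = 0 := by
  by_contra hd
  obtain ⟨r, hr⟩ := hg.exists_not_edge _ hd (Q 0).phase (Q' 0).phase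
  obtain ⟨l, h1, h2, h3⟩ := exists_mem_window hg.pos 0 (r + s)
  refine hr _ _ (hQ.phase_eq ((l - s) / n)) (hQ'.phase_eq ((l - s') / n)) ?_
  have := h l
  simpa [column, h3, add_sub_assoc] using this

lemma eq_of_block (hg : IsSync E g) {s k : ℤ} {Q Q' : ℤ → ColState ρ m}
    (h : ∀ l, s + k * n ≤ l → l < s + k * n + n → column g s Q l = column g s Q' l) :
    Q k = Q' k := by
  refine hg.inj _ _ fun r => ?_
  obtain ⟨l, h1, h2, h3, h4⟩ := exists_mem_block hg.pos s k r
  have := h l h1 h2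
  rwa [column, column, h3, h4] at this

lemma adj_of_edge (hg : IsSync E g) {s : ℤ} {Q Q' : ℤ → ColState ρ m}
    (h : ∀ l, E (column g s Q l) (column g s Q' l)) (k : ℤ) : Adj (Q k) (Q' k) := by
  refine hg.adj _ _ fun r => ?_
  obtain ⟨l, h1, h2, h3, h4⟩ := exists_mem_block hg.pos s k r
  have := h l
  rwa [column, column, h3, h4] at this

end IsSync

end ColState

/-- A shift-invariant set of sequences that is determined by its words of length `N` is an SFT. -/
lemma isSFT1_of_windows {A : Type*} [Finite A] {W : Set (ℤ → A)} (N : ℕ)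
    (hW : ∀ x ∈ W, ∀ p : ℤ, (fun l => x (l + p)) ∈ W)
    (h : ∀ x : ℤ → A, (∀ l₀ : ℤ, ∃ y ∈ W, ∀ l, l₀ ≤ l → l < l₀ + N → x l = y l) → x ∈ W) :
    IsSFT1 W := by
  have hfin : {w : List A | w.length = N ∧ ∀ y ∈ W, ¬ occursIn1 w y}.Finite :=
    (List.finite_length_eq A N).subset fun w hw => hw.1
  refine ⟨hfin.toFinset, Set.Subset.antisymm (fun x hx w hw => ?_) fun x hx => h x fun l₀ => ?_⟩
  · exact (hfin.mem_toFinset.1 hw).2 x hx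
  · by_contra! hc
    refine hx (List.ofFn fun j : Fin N => x (l₀ + j)) (hfin.mem_toFinset.2 ⟨by simp, ?_⟩)
      ⟨l₀, by simp⟩
    rintro y hy ⟨i, hi⟩
    obtain ⟨l, h1, h2, h3⟩ := hc _ (hW y hy (i - l₀))
    have h4 := hi (l - l₀).toNat (by rw [List.length_ofFn]; omega)
    simp only [List.get_eq_getElem, List.getElem_ofFn] at h4
    rw [Int.toNat_of_nonneg (by omega)] at h4
    exact h3 (by rw [show l + (i - l₀) = i + (l - l₀) by ring, h4]; congr 1; ring)

namespace ColState

variable {A C : Type*} {E : A → A → Prop} {ρ vert : C → C → Prop} {m n : ℕ}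
  {g : ZMod n → ColState ρ m → A}

lemma IsSync.isSFT1_columns [Finite A] (hg : IsSync E g) (vert : C → C → Prop) :
    IsSFT1 (columns vert g) := by
  have hn := hg.pos
  refine isSFT1_of_windows (2 * n) ?_ fun x hx => ?_
  · rintro _ ⟨s, Q, hQ, rfl⟩ p
    refine ⟨s - p, Q, hQ, funext fun l => ?_⟩
    simp only [column]
    rw [show l - (s - p) = l + p - s by ring]
  have hx' : ∀ l₀ : ℤ, ∃ s Q, IsStack vert Q ∧
      ∀ l, l₀ ≤ l → l < l₀ + (2 * n : ℕ) → x l = column g s Q l := by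
    intro l₀
    obtain ⟨_, ⟨s, Q, hQ, rfl⟩, h⟩ := hx l₀
    exact ⟨s, Q, hQ, h⟩
  choose s Q hQ hs using hx'
  have hstep : ∀ l, ((s (l + 1) : ℤ) : ZMod n) = s l := by
    intro l
    refine (sub_eq_zero.1 ?_ : ((s (l + 1) : ℤ) : ZMod n) = s l)
    rw [← Int.cast_sub]
    refine hg.offset_eq_of_window (hQ (l + 1)) (hQ l) (l + 1) fun k h1 h2 => ?_
    rw [← hs (l + 1) k (by omega) (by omega), hs l k (by omega) (by omega)]
  have hall : ∀ l, ((s l : ℤ) : ZMod n) = s 0 := by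
    intro l
    induction l using Int.induction_on with
    | zero => rfl
    | succ k ih => rw [hstep, ih]
    | pred k ih => rw [← ih, ← hstep, sub_add_cancel]
  have hR : ∀ k, ∃ R : ℤ → ColState ρ m, IsStack vert R ∧
      ∀ l, s 0 + k * n ≤ l → l < s 0 + k * n + (2 * n : ℕ) → x l = column g (s 0) R l := by
    intro k
    obtain ⟨t, ht⟩ := column_congr hn g (s := s (s 0 + k * n)) (s' := s 0)
      (by rw [Int.cast_sub, hall, sub_self]) (Q (s 0 + k * n))
    exact ⟨_, (hQ _).shift t, fun l h1 h2 => by rw [← ht]; exact hs _ l h1 h2⟩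
  choose R hRst hRx using hR
  have hnext : ∀ k, R k (k + 1) = R (k + 1) (k + 1) := by
    intro k
    refine hg.eq_of_block (s := s 0) fun l h1 h2 => ?_
    rw [← hRx (k + 1) l h1 (by push_cast; linarith),
      hRx k l (by nlinarith) (by push_cast; linarith)]
  refine ⟨s 0, fun k => R k k, fun k => ?_, funext fun l => ?_⟩
  · beta_reduce
    rw [← hnext]
    exact hRst k k
  · have h1 := Int.mul_ediv_add_emod (l - s 0) n
    have h2 := Int.emod_nonneg (l - s 0) (b := n) (by omega)
    have h3 := Int.emod_lt_of_pos (l - s 0) (b := n) (by omega)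
    exact hRx ((l - s 0) / n) l (by linarith) (by push_cast; linarith)

end ColState

/-! ### Configurations encoding arrays of column states -/

namespace ColState

variable {A C : Type*} {E : A → A → Prop} {ρ vert : C → C → Prop} {m n : ℕ}
  {g : ZMod n → ColState ρ m → A}

/-- Arrays of column states obeying the horizontal and vertical constraints. -/
def IsArray (vert : C → C → Prop) (Q : ℤ → ℤ → ColState ρ m) : Prop :=
  (∀ i k, Adj (Q i k) (Q (i + 1) k)) ∧ ∀ i, IsStack vert (Q i)

lemma IsArray.phase_eq {Q : ℤ → ℤ → ColState ρ m} (hQ : IsArray vert Q) (i k : ℤ) :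
    (Q i k).phase = (Q 0 0).phase + i := by
  rw [(hQ.2 i).phase_eq]
  induction i using Int.induction_on with
  | zero => simp
  | succ i ih => rw [(hQ.1 _ _).1, ih]; push_cast; ring
  | pred i ih =>
    have h := (hQ.1 (-i - 1) 0).1
    rw [sub_add_cancel, ih] at h
    rw [← sub_eq_iff_eq_add.2 h]
    push_cast
    ring

lemma IsArray.shift {Q : ℤ → ℤ → ColState ρ m} (hQ : IsArray vert Q) (a t : ℤ) :
    IsArray vert fun i k => Q (i - a) (k - t) := by
  refine ⟨fun i k => ?_, fun i => (hQ.2 _).shift t⟩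
  have := hQ.1 (i - a) (k - t)
  rwa [sub_add_eq_add_sub] at this

/-- The configuration whose columns read the columns of an array. -/
def render (g : ZMod n → ColState ρ m → A) (s : ℤ) (Q : ℤ → ℤ → ColState ρ m) : ℤ × ℤ → A :=
  fun p => column g s (Q p.1) p.2

lemma shift2_render (s a b : ℤ) (Q : ℤ → ℤ → ColState ρ m) :
    shift2 (a, b) (render g s Q) = render g (s + b) fun i k => Q (i - a) (k - 0) := by
  funext ⟨i, l⟩
  simp [shift2, render, column, sub_add_eq_sub_sub_swap]

lemma render_add_mul (hn : 0 < n) (s t : ℤ) (Q : ℤ → ℤ → ColState ρ m) :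
    render g (s + t * n) Q = render g s fun i k => Q (i - 0) (k - t) := by
  funext ⟨i, l⟩
  simp only [render, column, sub_zero]
  rw [show l - (s + t * n) = l - s - n * t by ring,
    Int.sub_mul_ediv_left _ _ (by exact_mod_cast hn.ne')]
  simp

lemma IsSync.render_inj (hg : IsSync E g) {s : ℤ} {Q Q' : ℤ → ℤ → ColState ρ m}
    (h : render g s Q = render g s Q') : Q = Q' :=
  funext fun i => funext fun _ => hg.eq_of_block (s := s) fun l _ _ => congrFun h (i, l)

lemma IsSync.render_offset (hg : IsSync E g) {s s' : ℤ} {Q Q' : ℤ → ℤ → ColState ρ m}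
    (hQ : IsArray vert Q) (hQ' : IsArray vert Q') (h : render g s Q = render g s' Q') :
    ((s - s' : ℤ) : ZMod n) = 0 :=
  hg.offset_eq_of_window (hQ.2 0) (hQ'.2 0) 0 fun l _ _ => congrFun h (0, l)

lemma IsSync.render_mem (hg : IsSync E g) {Q : ℤ → ℤ → ColState ρ m} (hQ : IsArray vert Q)
    (s : ℤ) : render g s Q ∈ XHV (vertexShift E) (columns vert g) :=
  ⟨fun _ _ => hg.edge _ _ _ (hQ.1 _ _), fun i => ⟨s, Q i, hQ.2 i, rfl⟩⟩

lemma IsSync.exists_render (hg : IsSync E g) {x : ℤ × ℤ → A}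
    (hx : x ∈ XHV (vertexShift E) (columns vert g)) :
    ∃ s Q, IsArray vert Q ∧ x = render g s Q := by
  have hn := hg.pos
  obtain ⟨hrow, hcol⟩ := hx
  choose s Q hQ hs using hcol
  have hstep : ∀ i, ((s i : ℤ) : ZMod n) = s (i + 1) := by
    intro i
    refine (sub_eq_zero.1 ?_ : ((s i : ℤ) : ZMod n) = s (i + 1))
    rw [← Int.cast_sub]
    refine hg.offset_eq_of_edge (hQ i) (hQ (i + 1)) fun l => ?_
    rw [← hs, ← hs]
    exact hrow l i
  have hall : ∀ i, ((s i : ℤ) : ZMod n) = s 0 := by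
    intro i
    induction i using Int.induction_on with
    | zero => rfl
    | succ k ih => rw [← hstep, ih]
    | pred k ih => rw [← ih, hstep, sub_add_cancel]
  have hR : ∀ i, ∃ R : ℤ → ColState ρ m, IsStack vert R ∧
      (fun l => x (i, l)) = column g (s 0) R := by
    intro i
    obtain ⟨t, ht⟩ := column_congr hn g (s := s i) (s' := s 0)
      (by rw [Int.cast_sub, hall, sub_self]) (Q i)
    exact ⟨_, (hQ i).shift t, by rw [← ht, hs]⟩
  choose R hRst hRx using hR
  refine ⟨s 0, R, ⟨fun i k => hg.adj_of_edge (s := s 0) (fun l => ?_) k, hRst⟩,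
    funext fun p => congrFun (hRx p.1) p.2⟩
  rw [← hRx, ← hRx]
  exact hrow l i

/-- The configurations of symbols obeying the horizontal relation `ρ` and the vertical relation
`vert`. -/
def conf (ρ vert : C → C → Prop) : Set (ℤ × ℤ → C) :=
  {c | ∀ a k, ρ (c (a, k)) (c (a + 1, k)) ∧ vert (c (a, k)) (c (a, k + 1))}

lemma ediv_sub_one (hm : 0 < m) (i : ℤ) (hi : (i : ZMod m) ≠ 0) : (i - 1) / m = i / m := by
  have h0 : i % m ≠ 0 := fun h => hi <| by
    rw [ZMod.intCast_zmod_eq_zero_iff_dvd]; exact Int.dvd_of_emod_eq_zero h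
  have h1 := Int.mul_ediv_add_emod i m
  have h2 := Int.emod_nonneg i (b := m) (by omega)
  have h3 := Int.emod_lt_of_pos i (b := m) (by omega)
  rw [Int.ediv_eq_iff_of_pos (by omega)]
  constructor <;> nlinarith [show 1 ≤ i % m by omega]

lemma mul_sub_one_ediv (hm : 0 < m) (a : ℤ) : (m * a - 1) / m = a - 1 := by
  rw [Int.ediv_eq_iff_of_pos (by omega)]
  constructor <;> nlinarith

/-- The symbol of the configuration `c` visible in column `i` and block `k`. -/
def symbol (m : ℕ) (c : ℤ × ℤ → C) (i k : ℤ) : C := c ((i - 1) / m + 1, k)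

/-- The array spreading each column of a configuration over `m` columns. -/
def arrayOf (hm : 0 < m) (c : conf ρ vert) (i k : ℤ) : ColState ρ m :=
  ⟨(i, symbol m c (i - 1) k, symbol m c i k), by
    refine ⟨fun hi => ?_, fun hi => ?_⟩
    · have h0 : (i : ZMod m) - 1 = 0 := sub_eq_zero.2 hi
      obtain ⟨a, ha⟩ := (ZMod.intCast_zmod_eq_zero_iff_dvd (i - 1) m).1 (by simpa using h0)
      simp only [symbol]
      have h1 : (i - 1 - 1) / (m : ℤ) + 1 = a := by
        rw [ha, mul_sub_one_ediv hm, sub_add_cancel]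
      have h2 : (i - 1) / (m : ℤ) = a := by rw [ha, Int.mul_ediv_cancel_left _ (by omega)]
      rw [h1, h2]
      exact (c.2 a k).1
    · simp only [symbol]
      rw [ediv_sub_one hm (i - 1)]
      simpa [sub_eq_zero] using hi⟩

lemma symbol_mul (hm : 0 < m) (c : ℤ × ℤ → C) (a k : ℤ) : symbol m c (m * a) k = c (a, k) := by
  rw [symbol, mul_sub_one_ediv hm, sub_add_cancel]

lemma isArray_arrayOf (hm : 0 < m) (c : conf ρ vert) : IsArray vert (arrayOf hm c) := by
  refine ⟨fun i k => ⟨by simp [arrayOf, phase], by simp [arrayOf, tgt, src]⟩, fun i k =>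
    ⟨rfl, fun hi => ?_⟩⟩
  obtain ⟨a, rfl⟩ := (ZMod.intCast_zmod_eq_zero_iff_dvd i m).1 hi
  simp only [tgt, arrayOf, symbol_mul hm]
  exact (c.2 a k).2

lemma IsArray.exists_arrayOf (hm : 0 < m) {Q : ℤ → ℤ → ColState ρ m} (hQ : IsArray vert Q)
    (h0 : (Q 0 0).phase = 0) : ∃ c : conf ρ vert, Q = arrayOf hm c := by
  have hph : ∀ i k, (Q i k).phase = i := fun i k => by rw [hQ.phase_eq, h0, zero_add]
  have hconst : ∀ i k, ((i : ℤ) : ZMod m) ≠ 0 → (Q (i + 1) k).tgt = (Q i k).tgt := by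
    intro i k hi
    rw [(hQ.1 i k).2, src_eq_tgt]
    rw [hph]
    simpa using hi
  have hrun : ∀ a k, ∀ j : ℕ, j < m → (Q (m * a + 1 + j) k).tgt = (Q (m * a + 1) k).tgt := by
    intro a k j
    induction j with
    | zero => simp
    | succ j ih =>
      intro hj
      rw [Nat.cast_succ, ← add_assoc, hconst, ih (by omega)]
      have hne : ((j + 1 : ℕ) : ZMod m) ≠ 0 := by
        rw [Ne, ZMod.natCast_eq_zero_iff]
        exact fun hd => absurd (Nat.le_of_dvd (by omega) hd) (by omega)
      push_cast at hne ⊢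
      simpa [add_comm] using hne
  have hend : ∀ a k, (Q (m * (a + 1)) k).tgt = (Q (m * a + 1) k).tgt := by
    intro a k
    rw [← hrun a k (m - 1) (by omega)]
    congr 2
    push_cast [Nat.one_le_iff_ne_zero.2 hm.ne']
    ring
  have hsym : ∀ i k, (Q i k).tgt = symbol m (fun p => (Q (m * p.1) p.2).tgt) i k := by
    intro i k
    have h1 := Int.mul_ediv_add_emod (i - 1) m
    have h2 := Int.emod_nonneg (i - 1) (b := m) (by omega)
    have h3 := Int.emod_lt_of_pos (i - 1) (b := m) (by omega)
    have h4 := hrun ((i - 1) / m) k ((i - 1) % m).toNat (by omega)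
    rw [Int.toNat_of_nonneg h2, show (m : ℤ) * ((i - 1) / m) + 1 + (i - 1) % m = i by omega] at h4
    rw [h4, ← hend, symbol]
  refine ⟨⟨fun p => (Q (m * p.1) p.2).tgt, fun a k => ⟨?_, ?_⟩⟩, ?_⟩
  · have h1 := (Q (m * a + 1) k).rel (by rw [hph]; simp)
    rw [← (hQ.1 _ k).2, ← hend] at h1
    exact h1
  · exact (hQ.2 _ k).2 (by rw [hph]; simp)
  · funext i k
    refine ColState.ext (hph i k) ?_ (hsym i k)
    have h1 := (hQ.1 (i - 1) k).2
    rw [sub_add_cancel] at h1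
    rw [← h1]
    exact hsym (i - 1) k

end ColState

/-! ### Roots -/

lemma shift2_add {A : Type*} (v w : ℤ × ℤ) (x : ℤ × ℤ → A) :
    shift2 v (shift2 w x) = shift2 (v + w) x := by
  funext k
  simp [shift2, sub_sub]

lemma shift2_zero {A : Type*} (x : ℤ × ℤ → A) : shift2 0 x = x := by
  funext k
  simp [shift2]

lemma continuous_shift2 {A : Type*} [TopologicalSpace A] (v : ℤ × ℤ) :
    Continuous (shift2 v : (ℤ × ℤ → A) → ℤ × ℤ → A) :=
  continuous_pi fun _ => continuous_apply _

/-- An equivariant embedding of a compact subshift `Y` whose shifted images partition `X` makes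
`X` a root of `Y`. -/
lemma isRoot_of_embedding {A B : Type*} [TopologicalSpace A] [T2Space A] [TopologicalSpace B]
    {X : Set (ℤ × ℤ → A)} {Y : Set (ℤ × ℤ → B)} {m n : ℕ} (hm : 0 < m) (hn : 0 < n)
    (hYc : IsCompact Y) (hYs : ∀ v, ∀ y ∈ Y, shift2 v y ∈ Y) (ψ : Y → ℤ × ℤ → A)
    (hψ : Continuous ψ) (hinj : Function.Injective ψ)
    (heq : ∀ (y : Y) (k₁ k₂ : ℤ),
      ψ ⟨shift2 (k₁, k₂) y, hYs _ _ y.2⟩ = shift2 (k₁ * m, k₂ * n) (ψ y))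
    (hX : ∀ y v, shift2 v (ψ y) ∈ X)
    (huniq : ∀ x ∈ X, ∃! q : Fin m × Fin n, x ∈ shift2 ((q.1 : ℤ), (q.2 : ℤ)) '' Set.range ψ) :
    IsRoot X Y m n := by
  have hrange : ∀ k₁ k₂ : ℤ,
      shift2 (k₁ * (m : ℤ), k₂ * (n : ℤ)) '' Set.range ψ = Set.range ψ := by
    intro k₁ k₂
    refine Set.Subset.antisymm ?_ ?_
    · rintro _ ⟨_, ⟨y, rfl⟩, rfl⟩
      exact ⟨_, heq y k₁ k₂⟩
    · rintro _ ⟨y, rfl⟩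
      refine ⟨_, ⟨_, heq y (-k₁) (-k₂)⟩, ?_⟩
      rw [shift2_add]
      convert shift2_zero (ψ y) using 2
      simp
  have : CompactSpace Y := isCompact_iff_compactSpace.1 hYc
  have hclosed : ∀ v, IsClosed (shift2 v '' Set.range ψ) := fun v =>
    ((isCompact_range hψ).image (continuous_shift2 v)).isClosed
  have h0 : Set.range ψ = shift2 ((((⟨0, hm⟩ : Fin m) : ℕ) : ℤ), (((⟨0, hn⟩ : Fin n) : ℕ) : ℤ)) ''
      Set.range ψ := by simpa using (hrange 0 0).symm
  have hopen : IsOpen {x : X | (x : ℤ × ℤ → A) ∈ Set.range ψ} := by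
    have hc : IsClosed (⋃ q : {q : Fin m × Fin n // q ≠ (⟨0, hm⟩, ⟨0, hn⟩)},
        ((↑) : X → ℤ × ℤ → A) ⁻¹' (shift2 ((q.1.1 : ℤ), (q.1.2 : ℤ)) '' Set.range ψ)) :=
      isClosed_iUnion_of_finite fun q => (hclosed _).preimage continuous_subtype_val
    convert hc.isOpen_compl using 1
    ext x
    obtain ⟨q, hq, hqu⟩ := huniq x x.2
    simp only [Set.mem_compl_iff, Set.mem_iUnion, Set.mem_preimage, Set.mem_ofPred_eq,
      Subtype.exists, not_exists]
    constructor
    · intro hx q' hne hx'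
      rw [h0] at hx
      exact hne ((hqu q' hx').trans (hqu (⟨0, hm⟩, ⟨0, hn⟩) hx).symm)
    · intro hx
      by_cases hq0 : q = (⟨0, hm⟩, ⟨0, hn⟩)
      · rw [h0]
        rwa [hq0] at hq
      · exact absurd hq (hx q hq0)
  refine ⟨Set.range ψ, ?_, ⟨?_, hopen⟩, by simpa using hrange 1 0, by simpa using hrange 0 1, ?_,
    ?_, huniq⟩
  · rintro _ ⟨y, rfl⟩
    simpa [shift2_zero] using hX y 0
  · rw [h0]
    exact (hclosed _).preimage continuous_subtype_val
  · let e : Y ≃ Set.range ψ := Equiv.ofInjective ψ hinj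
    have he : Continuous e := hψ.subtype_mk _
    refine ⟨(he.homeoOfEquivCompactToT2).symm, fun x k₁ k₂ hx => ?_⟩
    obtain ⟨y, rfl⟩ := e.surjective x
    have h1 : (⟨shift2 (k₁ * (m : ℤ), k₂ * (n : ℤ)) (e y : ℤ × ℤ → A), hx⟩ : Set.range ψ) =
        e ⟨shift2 (k₁, k₂) y, hYs _ _ y.2⟩ := Subtype.ext (heq y k₁ k₂).symm
    rw [h1]
    exact (congrArg Subtype.val (e.symm_apply_apply _)).trans
      (congrArg (fun y : Y => shift2 (k₁, k₂) (y : ℤ × ℤ → B)) (e.symm_apply_apply y).symm)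
  · rintro i j - - _ ⟨_, ⟨y, rfl⟩, rfl⟩
    exact hX y _

namespace ColState

variable {A C : Type*} {E : A → A → Prop} {ρ vert : C → C → Prop} {m n : ℕ}
  {g : ZMod n → ColState ρ m → A}

lemma symbol_shift (hm : 0 < m) (c : ℤ × ℤ → C) (k₁ k₂ i k : ℤ) :
    symbol m (shift2 (k₁, k₂) c) i k = symbol m c (i - k₁ * m) (k - k₂) := by
  simp only [symbol, shift2, Prod.mk_sub_mk]
  rw [show i - k₁ * m - 1 = i - 1 - m * k₁ by ring, Int.sub_mul_ediv_left _ _ (by omega),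
    sub_add_eq_add_sub]

lemma render_arrayOf_shift (hm : 0 < m) (hn : 0 < n) (c c' : conf ρ vert) (k₁ k₂ : ℤ)
    (h : (c' : ℤ × ℤ → C) = shift2 (k₁, k₂) c) :
    render g 0 (arrayOf hm c') = shift2 (k₁ * m, k₂ * n) (render g 0 (arrayOf hm c)) := by
  rw [shift2_render, render_add_mul hn]
  congr 1
  funext i k
  refine Subtype.ext (Prod.ext (by simp [arrayOf]) (Prod.ext ?_ ?_)) <;>
    simp only [arrayOf, h, symbol_shift hm, sub_zero, sub_right_comm]

lemma continuous_render_arrayOf [TopologicalSpace A] [TopologicalSpace C] [DiscreteTopology C]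
    (hm : 0 < m) (s : ℤ) :
    Continuous fun c : conf ρ vert => render g s (arrayOf hm c) := by
  refine continuous_pi fun p => IsLocallyConstant.continuous ?_
  refine (IsLocallyConstant.iff_eventually_eq _).2 fun c => ?_
  have key : ∀ q, ∀ᶠ c' : conf ρ vert in nhds c, (c' : ℤ × ℤ → C) q = (c : ℤ × ℤ → C) q := fun q =>
    (IsLocallyConstant.iff_eventually_eq _).1 (IsLocallyConstant.iff_continuous _ |>.2
      ((continuous_apply q).comp continuous_subtype_val)) c
  filter_upwards [key ((p.1 - 1) / m + 1, (p.2 - s) / n),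
    key ((p.1 - 1 - 1) / m + 1, (p.2 - s) / n)] with c' h1 h2
  simp only [render, column]
  congr 1
  exact Subtype.ext (Prod.ext rfl (Prod.ext h2 h1))

lemma arrayOf_injective (hm : 0 < m) :
    Function.Injective (arrayOf hm : conf ρ vert → ℤ → ℤ → ColState ρ m) := by
  refine fun c c' h => Subtype.ext (funext fun p => ?_)
  have h1 := congrArg tgt (congrFun (congrFun h (m * p.1)) p.2)
  simpa only [arrayOf, tgt, symbol_mul hm] using h1

lemma IsSync.existsUnique_shift (hg : IsSync E g) (hm : 0 < m) {x : ℤ × ℤ → A}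
    (hx : x ∈ XHV (vertexShift E) (columns vert g)) :
    ∃! q : Fin m × Fin n, ∃ c : conf ρ vert,
      shift2 ((q.1 : ℤ), (q.2 : ℤ)) (render g 0 (arrayOf hm c)) = x := by
  have hn := hg.pos
  have : NeZero m := ⟨hm.ne'⟩
  have : NeZero n := ⟨hn.ne'⟩
  obtain ⟨s, Q, hQ, rfl⟩ := hg.exists_render hx
  refine existsUnique_of_exists_of_unique ?_ ?_
  · obtain ⟨p, hp⟩ : ∃ p, p = (-(Q 0 0).phase).val := ⟨_, rfl⟩
    have hQ' := hQ.shift (-p) (s / n)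
    obtain ⟨c, hc⟩ := hQ'.exists_arrayOf hm (by
      rw [hQ.phase_eq, hp]
      simp)
    have hs : s = s % n + s / n * n := by rw [mul_comm, Int.emod_add_mul_ediv]
    have h2 := Int.emod_nonneg s (b := n) (by omega)
    have h3 := Int.emod_lt_of_pos s (b := n) (by omega)
    refine ⟨(⟨p, hp ▸ ZMod.val_lt _⟩, ⟨(s % n).toNat, by omega⟩), c, ?_⟩
    rw [shift2_render, ← hc]
    conv_rhs => rw [hs, render_add_mul hn]
    simp [h2]
  · rintro ⟨p, r⟩ ⟨p', r'⟩ ⟨c, hc⟩ ⟨c', hc'⟩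
    rw [← hc', shift2_render, shift2_render] at hc
    have hA := (isArray_arrayOf hm c).shift p 0
    have hA' := (isArray_arrayOf hm c').shift p' 0
    have hr := hg.render_offset hA hA' hc
    have hrr : r = r' := by
      have h1 : (((r : ℕ) : ZMod n)).val = (((r' : ℕ) : ZMod n)).val := by
        congr 1
        simpa [sub_eq_zero] using hr
      rw [ZMod.val_natCast_of_lt r.2, ZMod.val_natCast_of_lt r'.2] at h1
      exact Fin.ext h1
    subst hrr
    have hQQ := congrArg phase (congrFun (congrFun (hg.render_inj hc) 0) 0)
    have h1 : (((p : ℕ) : ZMod m)).val = (((p' : ℕ) : ZMod m)).val := by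
      congr 1
      simpa [arrayOf, phase] using hQQ
    rw [ZMod.val_natCast_of_lt p.2, ZMod.val_natCast_of_lt p'.2] at h1
    rw [Fin.ext h1]

end ColState

/-! ### Recoding a two-dimensional SFT by windows -/

section Recoding

variable {B : Type*} {D : Finset (ℤ × ℤ)}

/-- Overlap of two windows displaced by `e`. -/
def Overlap (e : ℤ × ℤ) (p p' : D → B) : Prop :=
  ∀ u w : D, (w : ℤ × ℤ) = u + e → p w = p' u

/-- Horizontal compatibility of windows: the windows overlap and the first one contains no
pattern of `F`. -/
def Allowed (F : Finset (Pattern2 B)) (p p' : D → B) : Prop :=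
  (∀ P ∈ F, ¬ ∀ u : D, (u : ℤ × ℤ) ∈ P.support → p u = P.val u) ∧ Overlap (1, 0) p p'

/-- The configuration of windows of a configuration. -/
def windows (D : Finset (ℤ × ℤ)) (y : ℤ × ℤ → B) : ℤ × ℤ → D → B := fun v u => y (u + v)

lemma windows_mem_conf {F : Finset (Pattern2 B)} (hD : ∀ P ∈ F, P.support ⊆ D)
    {y : ℤ × ℤ → B} (hy : y ∈ SFT2 F) :
    windows D y ∈ ColState.conf (Allowed F) (Overlap (D := D) (B := B) (0, 1)) := by
  refine fun a k => ⟨⟨fun P hP h => hy P hP ⟨(a, k), fun u hu => h ⟨u, hD P hP hu⟩ hu⟩,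
    fun u w h => ?_⟩, fun u w h => ?_⟩
  all_goals
    simp only [windows, h]
    congr 1
    ext <;> simp; ring

lemma overlap_nsmul {lo hi e : ℤ × ℤ} (he : 0 ≤ e)
    {c : ℤ × ℤ → ↥(Finset.Icc lo hi) → B}
    (hc : ∀ v, Overlap e (c v) (c (v + e))) (N : ℕ) :
    ∀ v, Overlap (N • e) (c v) (c (v + N • e)) := by
  induction N with
  | zero =>
    intro v u w h
    rw [zero_smul, add_zero] at h ⊢
    rw [Subtype.ext h]
  | succ N ih =>
    intro v u w h
    have hN : 0 ≤ N • e := nsmul_nonneg he N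
    rw [succ_nsmul'] at h ⊢
    have hu := Finset.mem_Icc.1 u.2
    have hw := Finset.mem_Icc.1 w.2
    have hmem : (u : ℤ × ℤ) + N • e ∈ Finset.Icc lo hi := by
      rw [Finset.mem_Icc]
      refine ⟨hu.1.trans (le_add_of_nonneg_right hN), le_trans ?_ hw.2⟩
      rw [h, add_comm e, ← add_assoc]
      exact le_add_of_nonneg_right he
    rw [hc v ⟨_, hmem⟩ w (by rw [h, add_comm e, add_assoc]), ih (v + e) u ⟨_, hmem⟩ rfl, add_assoc]

lemma overlap_zsmul {lo hi e : ℤ × ℤ} (he : 0 ≤ e)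
    {c : ℤ × ℤ → ↥(Finset.Icc lo hi) → B}
    (hc : ∀ v, Overlap e (c v) (c (v + e))) (z : ℤ) (v : ℤ × ℤ) :
    Overlap (z • e) (c v) (c (v + z • e)) := by
  obtain ⟨N, rfl | rfl⟩ := z.eq_nat_or_neg
  · simpa only [natCast_zsmul] using overlap_nsmul he hc N v
  · intro u w h
    rw [neg_smul, natCast_zsmul] at h ⊢
    have h1 := overlap_nsmul he hc N (v + -(N • e)) w u (by rw [h]; abel)
    rw [neg_add_cancel_right] at h1
    exact h1.symm

lemma exists_windows_eq {F : Finset (Pattern2 B)} {lo hi : ℤ × ℤ} (hlo : lo ≤ 0) (hhi : 0 ≤ hi)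
    {c : ℤ × ℤ → ↥(Finset.Icc lo hi) → B}
    (hc : c ∈ ColState.conf (Allowed F) (Overlap (0, 1))) :
    ∃ y ∈ SFT2 F, windows (Finset.Icc lo hi) y = c := by
  have h0 : (0 : ℤ × ℤ) ∈ Finset.Icc lo hi := Finset.mem_Icc.2 ⟨hlo, hhi⟩
  have h10 : ∀ v, Overlap (1, 0) (c v) (c (v + (1, 0))) := by
    rintro ⟨a, k⟩
    simpa only [Prod.mk_add_mk, add_zero] using (hc a k).1.2
  have h01 : ∀ v, Overlap (0, 1) (c v) (c (v + (0, 1))) := by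
    rintro ⟨a, k⟩
    simpa only [Prod.mk_add_mk, add_zero] using (hc a k).2
  have key : ∀ v u, c v u = c (u + v) ⟨0, h0⟩ := by
    rintro v ⟨⟨a, b⟩, hu⟩
    have hb : ((0, b) : ℤ × ℤ) ∈ Finset.Icc lo hi := by
      simp only [Finset.mem_Icc, Prod.le_def, Prod.fst_zero, Prod.snd_zero] at hu hlo hhi ⊢
      exact ⟨⟨hlo.1, hu.1.2⟩, hhi.1, hu.2.2⟩
    rw [overlap_zsmul (by simp [Prod.le_def]) h10 a v ⟨(0, b), hb⟩ ⟨(a, b), hu⟩ (by simp),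
      overlap_zsmul (by simp [Prod.le_def]) h01 b _ ⟨0, h0⟩ ⟨(0, b), hb⟩ (by simp)]
    refine congrFun (congrArg c ?_) _
    ext <;> simp [add_comm]
  refine ⟨fun v => c v ⟨0, h0⟩, fun P hP ⟨v, hv⟩ => ?_, funext fun v => funext fun u =>
    (key v u).symm⟩
  refine (hc v.1 v.2).1.1 P hP fun u hu => ?_
  rw [key]
  exact hv u hu

lemma exists_box (F : Finset (Pattern2 B)) : ∃ lo hi : ℤ × ℤ, lo ≤ 0 ∧ 0 ≤ hi ∧
    ∀ P ∈ F, P.support ⊆ Finset.Icc lo hi := by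
  classical
  obtain ⟨hi, hhi⟩ := (insert 0 (F.biUnion fun P => P.support)).bddAbove
  obtain ⟨lo, hlo⟩ := (insert 0 (F.biUnion fun P => P.support)).bddBelow
  refine ⟨lo, hi, hlo (by simp), hhi (by simp), fun P hP u hu => Finset.mem_Icc.2 ?_⟩
  have : u ∈ insert 0 (F.biUnion fun P => P.support) :=
    Finset.mem_insert_of_mem (Finset.mem_biUnion.2 ⟨P, hP, hu⟩)
  exact ⟨hlo this, hhi this⟩

lemma shift2_mem_SFT2 {F : Finset (Pattern2 B)} (v : ℤ × ℤ) {y : ℤ × ℤ → B}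
    (hy : y ∈ SFT2 F) : shift2 v y ∈ SFT2 F := by
  rintro P hP ⟨w, hw⟩
  refine hy P hP ⟨w - v, fun u hu => ?_⟩
  rw [← hw u hu, shift2, add_sub_assoc]

lemma isClosed_SFT2 [TopologicalSpace B] [DiscreteTopology B] (F : Finset (Pattern2 B)) :
    IsClosed (SFT2 F) := by
  have : SFT2 F = ⋂ P ∈ F, ⋂ v : ℤ × ℤ,
      (⋂ u ∈ P.support, (fun y : ℤ × ℤ → B => y (u + v)) ⁻¹' {P.val u})ᶜ := by
    ext y
    simp [SFT2, Pattern2.OccursIn]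
  rw [this]
  refine isClosed_biInter fun P _ => isClosed_iInter fun v => IsOpen.isClosed_compl ?_
  exact isOpen_biInter_finset fun u _ => (isOpen_discrete _).preimage (continuous_apply _)

end Recoding

/-- if the Rauzy graph of the nearest-neighbor SFT `H` does not satisfy
condition D, then every two-dimensional SFT `Y` is an `(m,n)`-th root of some combined
subshift `X_{H,V}`. -/
theorem stmt10 {A : Type*} [Fintype A] [TopologicalSpace A] [DiscreteTopology A]
    (E : A → A → Prop) (hout : ∀ a, ∃ b, E a b) (hin : ∀ a, ∃ b, E b a)
    (hD : ¬ ConditionD E)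
    {B : Type*} [Fintype B] [TopologicalSpace B] [DiscreteTopology B]
    (Y : Set (ℤ × ℤ → B)) (hY : ∃ FY : Finset (Pattern2 B), Y = SFT2 FY) :
    ∃ (V : Set (ℤ → A)) (m n : ℕ), IsSFT1 V ∧ 0 < m ∧ 0 < n ∧
      IsRoot (XHV (vertexShift E) V) Y m n := by
  obtain ⟨F, rfl⟩ := hY
  obtain ⟨lo, hi, hlo, hhi, hF⟩ := exists_box F
  obtain ⟨m, hm⟩ := exists_hasCycles hD
  have hm0 : 0 < m := lt_of_lt_of_le (by norm_num) hm.four_le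
  obtain ⟨n, g, hg⟩ := ColState.exists_isSync hm
    (Allowed F : (↥(Finset.Icc lo hi) → B) → _ → Prop)
  refine ⟨ColState.columns (Overlap (0, 1)) g, m, n, hg.isSFT1_columns _, hm0, hg.pos, ?_⟩
  let e : SFT2 F → ColState.conf (Allowed F)
      (Overlap (D := Finset.Icc lo hi) (B := B) (0, 1)) :=
    fun y => ⟨windows _ y, windows_mem_conf hF y.2⟩
  have hw : Continuous fun y : SFT2 F => windows (Finset.Icc lo hi) (y : ℤ × ℤ → B) :=
    continuous_pi fun v => continuous_pi fun u =>
      (continuous_apply (u + v)).comp continuous_subtype_val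
  have he : Continuous e := hw.subtype_mk _
  have hsurj : Function.Surjective e := by
    rintro ⟨c, hc⟩
    obtain ⟨y, hy, rfl⟩ := exists_windows_eq hlo hhi hc
    exact ⟨⟨y, hy⟩, rfl⟩
  have hinj : Function.Injective e := by
    refine fun y y' h => Subtype.ext (funext fun v => ?_)
    have h1 := congrFun (congrFun (congrArg Subtype.val h) v) ⟨0, Finset.mem_Icc.2 ⟨hlo, hhi⟩⟩
    simpa [e, windows] using h1
  refine isRoot_of_embedding hm0 hg.pos (isClosed_SFT2 F).isCompact
    (fun v y hy => shift2_mem_SFT2 v hy) (fun y => ColState.render g 0 (ColState.arrayOf hm0 (e y)))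
    ((ColState.continuous_render_arrayOf hm0 0).comp he)
    (fun y y' h => hinj (ColState.arrayOf_injective hm0 (hg.render_inj h)))
    (fun y k₁ k₂ => ColState.render_arrayOf_shift hm0 hg.pos _ _ _ _ ?_) (fun y v => ?_)
    (fun x hx => ?_)
  · funext v u
    simp only [e, windows, shift2, add_sub_assoc]
  · rw [ColState.shift2_render]
    exact hg.render_mem ((ColState.isArray_arrayOf hm0 (e y)).shift _ _) _
  · obtain ⟨q, ⟨c, hc⟩, hq⟩ := hg.existsUnique_shift hm0 hx
    obtain ⟨y, rfl⟩ := hsurj c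
    refine ⟨q, ⟨_, ⟨y, rfl⟩, hc⟩, ?_⟩
    rintro q' ⟨_, ⟨y', rfl⟩, h⟩
    exact hq q' ⟨e y', h⟩
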